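/- There exist pairings ⟨·,·⟩ : HC^{2n}_H(B) × K_0^H(B) → R(H) and ⟨·,·⟩ : HC^{2n+1}_H(B) × K_1^H(B) → R(H) such that for a cyclic cocycle f ∈ C^{2n}_H(B) and an H-invariant idempotent p ∈ End(X)⊗B one has ⟨[f],[p]⟩(ω) = (Ψ^{2n} f)(ω ⊗ p ⊗ ⋯ ⊗ p), and for a cyclic cocycle f ∈ C^{2n+1}_H(B) and an invertible H-invariant u ∈ End(X)⊗B one has ⟨[f],[u]⟩(ω) = (Ψ^{2n+1} f)(ω ⊗ (u^{-1}−1) ⊗ (u−1) ⊗ ⋯ ⊗ (u^{-1}−1) ⊗ (u−1)). In particular these expressions define H-invariant functionals on H, depend only on the cyclic cohomology class of f, on the equivalence class of p and on the K₁-class of u, and satisfy ⟨[f],[uv]⟩ = ⟨[f],[u]⟩ + ⟨[f],[v]⟩. -/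

import Mathlib

open scoped TensorProduct

noncomputable section

/-- A Hopf `ℂ`-algebra with invertible antipode, together with a chosen finite
(Sweedler) representation of the comultiplication: `Δ ω = ∑_{p ∈ Δl ω} p.1 ⊗ p.2`. -/
structure HopfData (H : Type) [Ring H] [HopfAlgebra ℂ H] where
  /-- the inverse of the antipode -/
  Sinv : H →ₗ[ℂ] H
  Sinv_antipode : ∀ ω : H, Sinv (HopfAlgebra.antipode (R := ℂ) ω) = ω
  antipode_Sinv : ∀ ω : H, HopfAlgebra.antipode (R := ℂ) (Sinv ω) = ω
  /-- a chosen list representation of the comultiplication -/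
  Δl : H → List (H × H)
  Δl_repr : ∀ ω : H,
    (Coalgebra.comul (R := ℂ) ω : H ⊗[ℂ] H) = ((Δl ω).map fun p => p.1 ⊗ₜ[ℂ] p.2).sum

variable {H : Type} [Ring H] [HopfAlgebra ℂ H]

/-- the counit, as a `ℂ`-valued function -/
def epsi (ω : H) : ℂ := Coalgebra.counit (R := ℂ) ω

/-- Iterated Sweedler decomposition: `sw n ω` represents
`Δⁿ ω = ∑_v v 0 ⊗ ⋯ ⊗ v n`, where `Δⁿ = (ι ⊗ Δ) Δ^{n-1}`. -/
def HopfData.sw (D : HopfData H) : (n : ℕ) → H → List (Fin (n + 1) → H)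
  | 0, ω => [fun _ => ω]
  | n + 1, ω =>
    (D.sw n ω).flatMap fun v =>
      (D.Δl (v (Fin.last n))).map fun p =>
        Fin.snoc (Function.update v (Fin.last n) p.1) p.2

/-- A right `H`-module structure (over `ℂ`), recorded as the antihomomorphism
`act : H → End(B)`, so `act ω b` stands for `b ◁ ω`. -/
structure RAct (H : Type) [Ring H] [HopfAlgebra ℂ H] (B : Type) [AddCommGroup B]
    [Module ℂ B] where
  act : H →ₗ[ℂ] B →ₗ[ℂ] B
  act_one : act 1 = LinearMap.id
  act_mul : ∀ ω η : H, act (ω * η) = (act η) ∘ₗ (act ω)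

/-- A unital right `H`-module algebra structure on `B`:
`(b₁ b₂) ◁ ω = ∑ (b₁ ◁ ω₍₀₎)(b₂ ◁ ω₍₁₎)` and `1 ◁ ω = ε(ω) 1`. -/
structure MAlg (D : HopfData H) (B : Type) [Ring B] [Algebra ℂ B] extends RAct H B where
  act_mul_mul : ∀ (ω : H) (b₁ b₂ : B),
    act ω (b₁ * b₂) = ((D.Δl ω).map fun p => act p.1 b₁ * act p.2 b₂).sum
  act_algOne : ∀ ω : H, act ω (1 : B) = epsi ω • (1 : B)


/-- the action as a plain function: `fn ω b = b ◁ ω` -/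
def RAct.fn {H : Type} [Ring H] [HopfAlgebra ℂ H] {B : Type} [AddCommGroup B] [Module ℂ B]
    (A : RAct H B) : H → B → B := fun ω x => A.act ω x

/-- the action of a module algebra as a plain function -/
def MAlg.fn {H : Type} [Ring H] [HopfAlgebra ℂ H] {B : Type} [Ring B] [Algebra ℂ B]
    {D : HopfData H} (A : MAlg D B) : H → B → B := A.toRAct.fn

/-- The space of `ℂ`-valued functions of one `H`-variable and `n+1` `B`-variables;
(multi)linear such functions correspond to linear functionals on `H ⊗ B^{⊗(n+1)}`. -/
abbrev Raw (H B : Type) (n : ℕ) := H → (Fin (n + 1) → B) → ℂ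

section Raw

variable {H : Type} [Ring H] [HopfAlgebra ℂ H] {B : Type} [Ring B] [Algebra ℂ B] {n : ℕ}

/-- `f` is linear in the `H`-variable and in each `B`-variable separately, i.e. `f`
is (the restriction of) a linear functional on `H ⊗ B^{⊗(n+1)}`. -/
def IsML (f : Raw H B n) : Prop :=
  (∀ ω η b, f (ω + η) b = f ω b + f η b) ∧
  (∀ (c : ℂ) ω b, f (c • ω) b = c * f ω b) ∧
  (∀ ω b (i : Fin (n + 1)) (x y : B),
    f ω (Function.update b i (x + y)) =
      f ω (Function.update b i x) + f ω (Function.update b i y)) ∧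
  (∀ ω b (i : Fin (n + 1)) (c : ℂ) (x : B),
    f ω (Function.update b i (c • x)) = c * f ω (Function.update b i x))

/-- `H`-invariance of the functional `f` on `H ⊗ B^{⊗(n+1)}`:
`(ω ▷ f)(η ⊗ b₀ ⊗ ⋯ ⊗ bₙ) = f(S⁻¹(ω₍₀₎) η ω₍₁₎ ⊗ b₀ ◁ ω₍₂₎ ⊗ ⋯ ⊗ bₙ ◁ ω₍ₙ₊₂₎)`
equals `ε(ω) f(η ⊗ b₀ ⊗ ⋯ ⊗ bₙ)`. -/
def IsInv (D : HopfData H) (act : H → B → B) (f : Raw H B n) : Prop :=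
  ∀ (ω η : H) (b : Fin (n + 1) → B),
    ((D.sw (n + 2) ω).map fun v =>
        f (D.Sinv (v 0) * η * v 1) fun i => act (v i.succ.succ) (b i)).sum
      = epsi ω * f η b

/-- membership in the equivariant cochain space `C^n_H(B)` -/
def InC (D : HopfData H) (act : H → B → B) (f : Raw H B n) : Prop :=
  IsML f ∧ IsInv D act f

/-- the cyclic operator
`(tₙ f)(ω ⊗ b₀ ⊗ ⋯ ⊗ bₙ) = f(ω₍₀₎ ⊗ bₙ ◁ ω₍₁₎ ⊗ b₀ ⊗ ⋯ ⊗ b_{n-1})` -/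
def tRaw (D : HopfData H) (act : H → B → B) (f : Raw H B n) : Raw H B n :=
  fun ω b =>
    ((D.Δl ω).map fun p =>
      f p.1 (Fin.cons (act p.2 (b (Fin.last n))) fun i : Fin n => b i.castSucc)).sum

/-- merging the `i`-th and `(i+1)`-st entries of a `(n+2)`-tuple by multiplication -/
def contract (i : Fin (n + 1)) (b : Fin (n + 2) → B) : Fin (n + 1) → B :=
  fun j =>
    if (j : ℕ) < (i : ℕ) then b j.castSucc
    else if (j : ℕ) = (i : ℕ) then b j.castSucc * b j.succ
    else b j.succ

/-- the coface operators `dⁿᵢ : C^{n} → C^{n+1}` (`i < n+1` multiplies adjacent entries;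
the last one is `d_{n+1} = t ∘ d₀`) -/
def dRaw (D : HopfData H) (act : H → B → B) (i : Fin (n + 2)) (f : Raw H B n) :
    Raw H B (n + 1) :=
  if h : (i : ℕ) < n + 1 then fun ω b => f ω (contract ⟨i, h⟩ b)
  else tRaw D act fun ω b => f ω (contract 0 b)

/-- the codegeneracy operators `sⁿᵢ : C^{n+1} → C^n`, inserting a `1` after the `i`-th entry -/
def sRaw (i : Fin (n + 1)) (f : Raw H B (n + 1)) : Raw H B n :=
  fun ω b => f ω (Fin.insertNth i.succ 1 b)

/-- the Hochschild coboundary `b = ∑ (-1)ⁱ dᵢ` -/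
def bRaw (D : HopfData H) (act : H → B → B) (f : Raw H B n) : Raw H B (n + 1) :=
  fun ω b => ∑ i : Fin (n + 2), ((-1 : ℂ) ^ (i : ℕ)) * dRaw D act i f ω b

/-- cyclicity: `λ f = (-1)ⁿ tₙ f = f` -/
def IsCyc (D : HopfData H) (act : H → B → B) (f : Raw H B n) : Prop :=
  ∀ ω b, ((-1 : ℂ) ^ n) * tRaw D act f ω b = f ω b

/-- an `n`-cocycle of the cyclic complex `(Ker(1-λ), b)` computing `HC^n_H(B)` -/
def IsCocycle (D : HopfData H) (act : H → B → B) (f : Raw H B n) : Prop :=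
  InC D act f ∧ IsCyc D act f ∧ ∀ ω b, bRaw D act f ω b = 0

end Raw

section Mat

variable {H : Type} [Ring H] [HopfAlgebra ℂ H]

/-- A finite-dimensional right `H`-module, presented as a matrix antirepresentation
`π : H → Matrix ι ι ℂ` (so `x ◁ ω` is the row vector `x · π(ω)`). -/
structure MRep (H : Type) [Ring H] [HopfAlgebra ℂ H] (ι : Type) [Fintype ι]
    [DecidableEq ι] where
  π : H →ₗ[ℂ] Matrix ι ι ℂ
  π_one : π 1 = 1
  π_mul : ∀ ω η : H, π (ω * η) = π η * π ω

variable {B : Type} [Ring B] [Algebra ℂ B]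
variable {ι κ : Type} [Fintype ι] [DecidableEq ι] [Fintype κ] [DecidableEq κ]

/-- The right `H`-action on `Hom(X, X') ⊗ B` (realized as rectangular matrices over `B`):
`(T ⊗ b) ◀ ω = π'(ω₍₀₎) T π(S⁻¹(ω₍₂₎)) ⊗ b ◁ ω₍₁₎`. -/
def matActR (D : HopfData H) (P : MRep H ι) (P' : MRep H κ) (A : RAct H B) :
    H → Matrix κ ι B → Matrix κ ι B :=
  fun ω M =>
    ((D.sw 2 ω).map fun v =>
      ((P'.π (v 0)).map (algebraMap ℂ B)) *
        (M.map fun x => A.act (v 1) x) *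
          ((P.π (D.Sinv (v 2))).map (algebraMap ℂ B))).sum

/-- the right `H`-action on `End(X) ⊗ B`, realized as `Matrix ι ι B` -/
def matAct (D : HopfData H) (P : MRep H ι) (A : RAct H B) :
    H → Matrix ι ι B → Matrix ι ι B :=
  matActR D P P A

/-- The map `Ψⁿ : C^n_H(B) → C^n_H(End(X) ⊗ B)`,
`(Ψⁿ f)(ω ⊗ (T₀⊗b₀) ⊗ ⋯ ⊗ (Tₙ⊗bₙ)) = f(ω₍₀₎ ⊗ b₀ ⊗ ⋯ ⊗ bₙ) Tr(π(S⁻¹(ω₍₁₎)) T₀ ⋯ Tₙ)`,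
written out on matrices over `B`. -/
def PsiRaw (D : HopfData H) (P : MRep H ι) {n : ℕ} (f : Raw H B n) :
    Raw H (Matrix ι ι B) n :=
  fun ω M =>
    ((D.Δl ω).map fun p =>
      ∑ k : Fin (n + 2) → ι,
        (P.π (D.Sinv p.2)) (k (Fin.last (n + 1))) (k 0) *
          f p.1 fun i => M i (k i.castSucc) (k i.succ)).sum

/-- the right `H`-action on `X ⊗ B` (tensor product action), `X` realized as row
vectors with matrix antirepresentation `P` -/
def ractV (D : HopfData H) (P : MRep H ι) (A : RAct H B) (ω : H) (v : ι → B) : ι → B :=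
  fun j => ((D.Δl ω).map fun p => ∑ i, (P.π p.1) i j • A.act p.2 (v i)).sum

/-- membership in `R(H)`, the `H`-invariant linear functionals on `H` (with the
adjoint action `η ◁ ω = S⁻¹(ω₍₀₎) η ω₍₁₎`) -/
def IsRH (D : HopfData H) (F : H → ℂ) : Prop :=
  (∀ ω η : H, F (ω + η) = F ω + F η) ∧
  (∀ (c : ℂ) (ω : H), F (c • ω) = c * F ω) ∧
  (∀ ω η : H, ((D.Δl ω).map fun p => F (D.Sinv p.1 * η * p.2)).sum = epsi ω * F η)

end Mat

/-- the alternating tuple `(u⁻¹-1, u-1, …, u⁻¹-1, u-1)` used in the odd pairing -/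
def altT {E : Type} [Ring E] (m : ℕ) (u u' : E) : Fin m → E :=
  fun i => if (i : ℕ) % 2 = 0 then u' - 1 else u - 1

set_option linter.unusedSectionVars false
set_option linter.unusedSimpArgs false

set_option linter.unusedSectionVars false
set_option linter.unusedSimpArgs false

lemma epsi_def (ω : H) : epsi ω = Coalgebra.counit (R := ℂ) ω := rfl

section Sweedler
variable {V W : Type*} [AddCommGroup V] [Module ℂ V] [AddCommGroup W] [Module ℂ W]

/-- Sweedler sum. -/
def sΔ (D : HopfData H) (ω : H) (g : H → H → V) : V := ((D.Δl ω).map fun p => g p.1 p.2).sum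

lemma sΔ_lift (D : HopfData H) (ω : H) (G : H →ₗ[ℂ] H →ₗ[ℂ] V) :
    sΔ D ω (fun a b => G a b) = TensorProduct.lift G (Coalgebra.comul (R := ℂ) ω) := by
  rw [D.Δl_repr, map_list_sum, List.map_map]; rfl

/-- bundle a bilinear function -/
def mkB (g : H → H → V) (h1 : ∀ b, IsLinearMap ℂ (fun a => g a b))
    (h2 : ∀ a, IsLinearMap ℂ (fun b => g a b)) : H →ₗ[ℂ] H →ₗ[ℂ] V :=
  LinearMap.mk₂ ℂ g (fun a a' b => (h1 b).map_add a a') (fun c a b => (h1 b).map_smul c a)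
    (fun a b b' => (h2 a).map_add b b') (fun c a b => (h2 a).map_smul c b)

lemma sΔ_lift' (D : HopfData H) (ω : H) (g : H → H → V) (h1 : ∀ b, IsLinearMap ℂ (fun a => g a b))
    (h2 : ∀ a, IsLinearMap ℂ (fun b => g a b)) :
    sΔ D ω g = TensorProduct.lift (mkB g h1 h2) (Coalgebra.comul (R := ℂ) ω) :=
  sΔ_lift D ω (mkB g h1 h2)

lemma sΔ_lin (D : HopfData H) (g : H → H → V) (h1 : ∀ b, IsLinearMap ℂ (fun a => g a b))
    (h2 : ∀ a, IsLinearMap ℂ (fun b => g a b)) : IsLinearMap ℂ (fun ω => sΔ D ω g) := by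
  constructor <;> intros <;> simp [sΔ_lift' D _ g h1 h2]

lemma sΔ_add (D : HopfData H) (ω : H) (g g' : H → H → V) :
    sΔ D ω (fun a b => g a b + g' a b) = sΔ D ω g + sΔ D ω g' := by
  simp [sΔ, List.sum_map_add]

lemma map_sΔ {F : Type*} [FunLike F V W] [AddMonoidHomClass F V W] (D : HopfData H) (ω : H)
    (g : H → H → V) (L : F) : L (sΔ D ω g) = sΔ D ω (fun a b => L (g a b)) := by
  simp [sΔ, map_list_sum, List.map_map, Function.comp_def]

lemma comul_eq (D : HopfData H) (ω : H) :
    Coalgebra.comul (R := ℂ) ω = sΔ D ω (fun a b => a ⊗ₜ[ℂ] b) := D.Δl_repr ω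

lemma sΔ_smul (D : HopfData H) (ω : H) (g : H → H → V) (c : ℂ) :
    sΔ D ω (fun a b => c • g a b) = c • sΔ D ω g :=
  (map_sΔ D ω g (c • (LinearMap.id : V →ₗ[ℂ] V))).symm

lemma sΔ_sum {K : Type*} (s : Finset K) (D : HopfData H) (ω : H) (g : K → H → H → V) :
    sΔ D ω (fun a b => ∑ k ∈ s, g k a b) = ∑ k ∈ s, sΔ D ω (g k) := by
  classical
  induction s using Finset.induction_on with
  | empty => simp [sΔ]
  | insert k s hk ih => simp [Finset.sum_insert hk, sΔ_add, ih]

lemma sΔ_swap (D : HopfData H) (ω η : H) (g : H → H → H → H → V) :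
    sΔ D ω (fun a b => sΔ D η (fun c d => g a b c d)) =
      sΔ D η (fun c d => sΔ D ω (fun a b => g a b c d)) := by
  unfold sΔ
  induction D.Δl ω with
  | nil => simp
  | cons x l ih => simp [ih, List.sum_map_add]

lemma sΔ_par_lin (D : HopfData H) (ω : H) {U : Type*} [AddCommGroup U] [Module ℂ U]
    (g : U → H → H → V) (h : ∀ a b, IsLinearMap ℂ (fun u => g u a b)) :
    IsLinearMap ℂ (fun u => sΔ D ω (g u)) := by
  constructor
  · intro x y
    rw [← sΔ_add]; congr 1; funext a b; exact (h a b).map_add x y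
  · intro c x
    rw [← sΔ_smul]; congr 1; funext a b; exact (h a b).map_smul c x

lemma sΔ_coassoc (D : HopfData H) (ω : H) (g : H → H → H → V)
    (h1 : ∀ b c, IsLinearMap ℂ (fun a => g a b c))
    (h2 : ∀ a c, IsLinearMap ℂ (fun b => g a b c))
    (h3 : ∀ a b, IsLinearMap ℂ (fun c => g a b c)) :
    sΔ D ω (fun x c => sΔ D x (fun a b => g a b c)) =
      sΔ D ω (fun a x => sΔ D x (fun b c => g a b c)) := by
  let G : H →ₗ[ℂ] H →ₗ[ℂ] H →ₗ[ℂ] V :=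
    LinearMap.mk₂ ℂ (fun a b => (h3 a b).mk' _)
      (fun a a' b => by ext c; exact (h1 b c).map_add a a')
      (fun r a b => by ext c; exact (h1 b c).map_smul r a)
      (fun a b b' => by ext c; exact (h2 a c).map_add b b')
      (fun r a b => by ext c; exact (h2 a c).map_smul r b)
  let L : H ⊗[ℂ] (H ⊗[ℂ] H) →ₗ[ℂ] V :=
    TensorProduct.lift ((TensorProduct.uncurry (.id ℂ) H H V) ∘ₗ G)
  have e := congrArg L (Coalgebra.coassoc_apply (R := ℂ) ω)
  have hL : ∀ a b c, L (a ⊗ₜ (b ⊗ₜ c)) = g a b c := fun a b c => by simp [L, G]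
  rw [comul_eq D] at e
  simp only [map_sΔ, LinearMap.rTensor_tmul, LinearMap.lTensor_tmul] at e
  simp only [comul_eq D] at e
  have e1 : ∀ x c : H, L ((TensorProduct.assoc ℂ H H H) ((sΔ D x fun a b => a ⊗ₜ[ℂ] b) ⊗ₜ[ℂ] c)) =
      sΔ D x (fun a b => g a b c) := by
    intro x c
    have := map_sΔ D x (fun a b => a ⊗ₜ[ℂ] b) (L ∘ₗ (TensorProduct.assoc ℂ H H H).toLinearMap ∘ₗ
      (TensorProduct.mk ℂ (H ⊗[ℂ] H) H).flip c)
    simpa [hL] using this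
  have e2 : ∀ a x : H, L (a ⊗ₜ[ℂ] (sΔ D x fun b c => b ⊗ₜ[ℂ] c)) =
      sΔ D x (fun b c => g a b c) := by
    intro a x
    have := map_sΔ D x (fun a b => a ⊗ₜ[ℂ] b) (L ∘ₗ (TensorProduct.mk ℂ H (H ⊗[ℂ] H)) a)
    simpa [hL] using this
  simpa only [e1, e2] using e

lemma sΔ_counit_left (D : HopfData H) (ω : H) (g : H → V) (h : IsLinearMap ℂ g) :
    sΔ D ω (fun a b => epsi a • g b) = g ω := by
  have e := congrArg (TensorProduct.lid ℂ H) (Coalgebra.rTensor_counit_comul (R := ℂ) ω)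
  rw [comul_eq D] at e
  simp only [map_sΔ, LinearMap.rTensor_tmul,
    TensorProduct.lid_tmul, one_smul] at e
  have e2 := congrArg (h.mk' g) e
  simpa only [map_sΔ, map_smul, IsLinearMap.mk'_apply, ← epsi_def] using e2

lemma sΔ_counit_right (D : HopfData H) (ω : H) (g : H → V) (h : IsLinearMap ℂ g) :
    sΔ D ω (fun a b => epsi b • g a) = g ω := by
  have e := congrArg (TensorProduct.rid ℂ H) (Coalgebra.lTensor_counit_comul (R := ℂ) ω)
  rw [comul_eq D] at e
  simp only [map_sΔ, LinearMap.lTensor_tmul,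
    TensorProduct.rid_tmul, one_smul] at e
  have e2 := congrArg (h.mk' g) e
  simpa only [map_sΔ, map_smul, IsLinearMap.mk'_apply, ← epsi_def] using e2

lemma sΔ_mul (D : HopfData H) (x y : H) (g : H → H → V) (h1 : ∀ b, IsLinearMap ℂ (fun a => g a b))
    (h2 : ∀ a, IsLinearMap ℂ (fun b => g a b)) :
    sΔ D (x * y) g = sΔ D x (fun a b => sΔ D y (fun c d => g (a * c) (b * d))) := by
  rw [sΔ_lift' D _ g h1 h2, Bialgebra.comul_mul, comul_eq D x, comul_eq D y]
  have e : ∀ t : H ⊗[ℂ] H, (sΔ D x fun a b => a ⊗ₜ[ℂ] b) * t = sΔ D x (fun a b => a ⊗ₜ[ℂ] b * t) :=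
    fun t => map_sΔ D x _ (LinearMap.mulRight ℂ t)
  have e' : ∀ t : H ⊗[ℂ] H, t * (sΔ D y fun a b => a ⊗ₜ[ℂ] b) = sΔ D y (fun a b => t * a ⊗ₜ[ℂ] b) :=
    fun t => map_sΔ D y _ (LinearMap.mulLeft ℂ t)
  simp only [e, e', map_sΔ, Algebra.TensorProduct.tmul_mul_tmul, TensorProduct.lift.tmul]
  rfl

lemma sΔ_antipode_right (D : HopfData H) (ω : H) :
    sΔ D ω (fun a b => a * HopfAlgebra.antipode ℂ b) = epsi ω • (1 : H) := by
  have e := HopfAlgebra.mul_antipode_lTensor_comul_apply (R := ℂ) ω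
  rw [comul_eq D] at e
  simpa only [map_sΔ, LinearMap.lTensor_tmul,
    LinearMap.mul'_apply, Algebra.algebraMap_eq_smul_one, ← epsi_def] using e

lemma sΔ_antipode_left (D : HopfData H) (ω : H) :
    sΔ D ω (fun a b => HopfAlgebra.antipode ℂ a * b) = epsi ω • (1 : H) := by
  have e := HopfAlgebra.mul_antipode_rTensor_comul_apply (R := ℂ) ω
  rw [comul_eq D] at e
  simpa only [map_sΔ, LinearMap.rTensor_tmul,
    LinearMap.mul'_apply, Algebra.algebraMap_eq_smul_one, ← epsi_def] using e


lemma lin_comp {U : Type*} [AddCommGroup U] [Module ℂ U] {g : W → V} {h : U → W}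
    (hg : IsLinearMap ℂ g) (hh : IsLinearMap ℂ h) : IsLinearMap ℂ (fun x => g (h x)) :=
  ⟨fun x y => by simp only [hh.map_add, hg.map_add],
    fun c x => by simp only [hh.map_smul, hg.map_smul]⟩

lemma lin_map {U : Type*} [AddCommGroup U] [Module ℂ U] (g : W →ₗ[ℂ] V) {h : U → W}
    (hh : IsLinearMap ℂ h) : IsLinearMap ℂ (fun x => g (h x)) := lin_comp g.isLinear hh

lemma lin_id : IsLinearMap ℂ (fun x : V => x) := LinearMap.id.isLinear

lemma lin_mul_right {R : Type*} [Ring R] [Algebra ℂ R] {h : V → R} (hh : IsLinearMap ℂ h) (c : R) :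
    IsLinearMap ℂ (fun x => h x * c) := lin_map (LinearMap.mulRight ℂ c) hh

lemma lin_mul_left {R : Type*} [Ring R] [Algebra ℂ R] {h : V → R} (c : R) (hh : IsLinearMap ℂ h) :
    IsLinearMap ℂ (fun x => c * h x) := lin_map (LinearMap.mulLeft ℂ c) hh

lemma lin_tmul_right {h : V → H} (hh : IsLinearMap ℂ h) (c : H) :
    IsLinearMap ℂ (fun x => h x ⊗ₜ[ℂ] c) := lin_map ((TensorProduct.mk ℂ H H).flip c) hh

lemma lin_tmul_left {h : V → H} (c : H) (hh : IsLinearMap ℂ h) :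
    IsLinearMap ℂ (fun x => c ⊗ₜ[ℂ] h x) := lin_map (TensorProduct.mk ℂ H H c) hh

lemma Sinv_mul (D : HopfData H) (a b : H) : D.Sinv (a * b) = D.Sinv b * D.Sinv a := by
  have := HopfAlgebra.antipode_mul_antidistrib (R := ℂ) (D.Sinv b) (D.Sinv a)
  rw [D.antipode_Sinv, D.antipode_Sinv] at this
  rw [← this, D.Sinv_antipode]

lemma Sinv_one (D : HopfData H) : D.Sinv 1 = 1 := by
  have := D.Sinv_antipode 1
  rwa [HopfAlgebra.antipode_one] at this

/-- `ω₁ S⁻¹(ω₀) = ε(ω)` -/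
lemma sΔ_Sinv_right (D : HopfData H) (ω : H) :
    sΔ D ω (fun a b => b * D.Sinv a) = epsi ω • (1 : H) := by
  have e := congrArg D.Sinv (sΔ_antipode_right D ω)
  simpa only [map_sΔ, Sinv_mul, D.Sinv_antipode, map_smul, Sinv_one] using e

/-- `S⁻¹(ω₁) ω₀ = ε(ω)` -/
lemma sΔ_Sinv_left (D : HopfData H) (ω : H) :
    sΔ D ω (fun a b => D.Sinv b * a) = epsi ω • (1 : H) := by
  have e := congrArg D.Sinv (sΔ_antipode_left D ω)
  simpa only [map_sΔ, Sinv_mul, D.Sinv_antipode, map_smul, Sinv_one] using e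

lemma sΔ_4 (D : HopfData H) (ω : H) (g : H → H → H → H → V)
    (h1 : ∀ b c d, IsLinearMap ℂ (fun a => g a b c d))
    (h2 : ∀ a c d, IsLinearMap ℂ (fun b => g a b c d))
    (h3 : ∀ a b d, IsLinearMap ℂ (fun c => g a b c d))
    (h4 : ∀ a b c, IsLinearMap ℂ (fun d => g a b c d)) :
    sΔ D ω (fun x y => sΔ D x (fun a b => sΔ D y (fun c d => g a b c d))) =
      sΔ D ω (fun a x => sΔ D x (fun b y => sΔ D y (fun c d => g a b c d))) :=
  sΔ_coassoc D ω (fun a b y => sΔ D y (fun c d => g a b c d))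
    (fun b y => sΔ_par_lin D y _ (fun c d => h1 b c d))
    (fun a y => sΔ_par_lin D y _ (fun c d => h2 a c d))
    (fun a b => sΔ_lin D _ (fun d => h3 a b d) (fun c => h4 a b c))

open WithConv in
lemma comul_antipode (D : HopfData H) (ω : H) :
    Coalgebra.comul (R := ℂ) (HopfAlgebra.antipode ℂ ω) =
      sΔ D ω (fun a b => HopfAlgebra.antipode ℂ b ⊗ₜ[ℂ] HopfAlgebra.antipode ℂ a) := by
  set S := HopfAlgebra.antipode ℂ (A := H) with hS
  let c : H →ₗ[ℂ] H ⊗[ℂ] H := TensorProduct.map S S ∘ₗ (TensorProduct.comm ℂ H H).toLinearMap ∘ₗ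
    Coalgebra.comul
  have hc : ∀ ω, c ω = sΔ D ω (fun a b => S b ⊗ₜ[ℂ] S a) := by
    intro ω
    simp only [c, LinearMap.comp_apply]
    rw [comul_eq D]
    simp [map_sΔ]
  have mulL : ∀ (x : H) (t : H ⊗[ℂ] H) (g : H → H → H ⊗[ℂ] H), sΔ D x g * t =
      sΔ D x (fun a b => g a b * t) :=
    fun x t g => map_sΔ D x _ (LinearMap.mulRight ℂ t)
  have mulR : ∀ (x : H) (t : H ⊗[ℂ] H) (g : H → H → H ⊗[ℂ] H), t * sΔ D x g =
      sΔ D x (fun a b => t * g a b) :=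
    fun x t g => map_sΔ D x _ (LinearMap.mulLeft ℂ t)
  have key : toConv ((Coalgebra.comul (R := ℂ) (A := H)) ∘ₗ S) = toConv c := by
    apply left_inv_eq_right_inv (a := toConv (Coalgebra.comul (R := ℂ) (A := H)))
    · apply WithConv.ofConv_injective
      ext x
      change LinearMap.mul' ℂ _ (TensorProduct.map _ _ (Coalgebra.comul (R := ℂ) x)) =
        algebraMap ℂ _ (Coalgebra.counit (R := ℂ) x)
      rw [comul_eq D x]
      simp only [map_sΔ, TensorProduct.map_tmul, LinearMap.mul'_apply, ofConv_toConv,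
        LinearMap.comp_apply, ← Bialgebra.comul_mul]
      rw [← map_sΔ, sΔ_antipode_left, map_smul, Bialgebra.comul_one,
        Algebra.algebraMap_eq_smul_one]
      rfl
    · apply WithConv.ofConv_injective
      ext x
      change LinearMap.mul' ℂ _ (TensorProduct.map _ _ (Coalgebra.comul (R := ℂ) x)) =
        algebraMap ℂ _ (Coalgebra.counit (R := ℂ) x)
      rw [comul_eq D x]
      simp only [map_sΔ, TensorProduct.map_tmul, LinearMap.mul'_apply, ofConv_toConv, hc]
      simp only [comul_eq D, mulL, mulR, Algebra.TensorProduct.tmul_mul_tmul]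
      rw [sΔ_4 D x (fun a b c d => (a * S d) ⊗ₜ[ℂ] (b * S c))
        (fun b c d => lin_tmul_right (lin_mul_right lin_id _) _)
        (fun b c d => lin_tmul_left _ (lin_mul_right lin_id _))
        (fun b c d => lin_tmul_left _ (lin_mul_left _ (lin_map S lin_id)))
        (fun b c d => lin_tmul_right (lin_mul_left _ (lin_map S lin_id)) _)]
      have : ∀ a y, sΔ D y (fun b y => sΔ D y fun c d => (a * S d) ⊗ₜ[ℂ] (b * S c)) =
          (a * S y) ⊗ₜ[ℂ] (1 : H) := by
        intro a y
        rw [← sΔ_coassoc D y (fun b c d => (a * S d) ⊗ₜ[ℂ] (b * S c))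
          (fun c d => lin_tmul_left _ (lin_mul_right lin_id _))
          (fun b d => lin_tmul_left _ (lin_mul_left _ (lin_map S lin_id)))
          (fun b c => lin_tmul_right (lin_mul_left _ (lin_map S lin_id)) _)]
        have h2 : ∀ x d, (sΔ D x fun b c => (a * S d) ⊗ₜ[ℂ] (b * S c)) =
            epsi x • ((a * S d) ⊗ₜ[ℂ] (1 : H)) := by
          intro x d
          have := map_sΔ D x (fun b c => b * S c) (TensorProduct.mk ℂ H H (a * S d))
          simp only [TensorProduct.mk_apply] at this
          rw [← this, sΔ_antipode_right, TensorProduct.tmul_smul]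
        simp only [h2]
        exact sΔ_counit_left D y (fun d => (a * S d) ⊗ₜ[ℂ] (1 : H))
          (lin_tmul_right (lin_mul_left _ (lin_map S lin_id)) _)
      simp only [this]
      have := map_sΔ D x (fun b c => b * S c) ((TensorProduct.mk ℂ H H).flip 1)
      simp only [TensorProduct.mk_apply, LinearMap.flip_apply] at this
      rw [← this, sΔ_antipode_right, ← TensorProduct.smul_tmul', Algebra.algebraMap_eq_smul_one]
      rfl
  have := LinearMap.congr_fun (WithConv.toConv_injective key) ω
  rw [hc] at this
  exact this

lemma comul_Sinv (D : HopfData H) (ω : H) :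
    Coalgebra.comul (R := ℂ) (D.Sinv ω) =
      sΔ D ω (fun a b => D.Sinv b ⊗ₜ[ℂ] D.Sinv a) := by
  have e := comul_antipode D (D.Sinv ω)
  rw [D.antipode_Sinv] at e
  have e2 := congrArg (TensorProduct.map D.Sinv D.Sinv ∘ₗ (TensorProduct.comm ℂ H H).toLinearMap) e
  simp only [map_sΔ, LinearMap.comp_apply, LinearEquiv.coe_coe, TensorProduct.comm_tmul,
    TensorProduct.map_tmul, D.Sinv_antipode] at e2
  rw [← comul_eq D] at e2
  rw [← e2, comul_eq D]
  simp [map_sΔ]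

lemma sΔ_Sinv (D : HopfData H) (x : H) (g : H → H → V) (h1 : ∀ b, IsLinearMap ℂ (fun a => g a b))
    (h2 : ∀ a, IsLinearMap ℂ (fun b => g a b)) :
    sΔ D (D.Sinv x) g = sΔ D x (fun a b => g (D.Sinv b) (D.Sinv a)) := by
  rw [sΔ_lift' D _ g h1 h2, comul_Sinv, map_sΔ]
  rfl

end Sweedler


section Iterated
variable {V : Type*} [AddCommGroup V] [Module ℂ V]

/-- iterated Sweedler sum -/
def sS (D : HopfData H) (m : ℕ) (ω : H) (g : (Fin (m + 1) → H) → V) : V := ((D.sw m ω).map g).sum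

lemma sS_zero (D : HopfData H) (ω : H) (g : (Fin 1 → H) → V) :
    sS D 0 ω g = g (fun _ => ω) := by
  simp [sS, HopfData.sw]

lemma list_sum_flatMap {X Y : Type*} (l : List X) (h : X → List Y) (g : Y → V) :
    ((l.flatMap h).map g).sum = (l.map fun x => ((h x).map g).sum).sum := by
  induction l with
  | nil => simp
  | cons a l ih => simp [List.flatMap_cons, ih]

lemma sS_succ_last (D : HopfData H) (m : ℕ) (ω : H) (g : (Fin (m + 2) → H) → V) :
    sS D (m + 1) ω g = sS D m ω (fun v => sΔ D (v (Fin.last m)) (fun a b =>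
      g (Fin.snoc (α := fun _ => H) (Function.update v (Fin.last m) a) b))) := by
  unfold sS sΔ
  rw [HopfData.sw, list_sum_flatMap]
  simp [List.map_map, Function.comp_def]

lemma sS_sΔ (D : HopfData H) (m : ℕ) (ω : H) (g : (Fin (m + 1) → H) → V) :
  sS D m ω g = ((D.sw m ω).map g).sum := rfl

lemma sS_succ_first (D : HopfData H) (m : ℕ) (ω : H) (g : (Fin (m + 2) → H) → V) :
    sS D (m + 1) ω g = sΔ D ω (fun a b => sS D m b (fun v =>
      g (Fin.cons (α := fun _ => H) a v))) := by
  induction m generalizing ω with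
  | zero =>
    rw [sS_succ_last, sS_zero]
    simp only [sS_zero]
    congr 1; funext a b; congr 1
    funext i
    fin_cases i
    · change Fin.snoc (α := fun _ => H) _ b (Fin.castSucc 0) = Fin.cons (α := fun _ => H) a _ 0
      rw [Fin.snoc_castSucc]; rfl
    · change Fin.snoc (α := fun _ => H) _ b (Fin.last 1) = Fin.cons (α := fun _ => H) a _ (Fin.succ 0)
      rw [Fin.snoc_last, Fin.cons_succ]
  | succ m ih =>
    rw [sS_succ_last, ih]
    congr 1; funext a b
    rw [sS_succ_last]
    congr 1; funext v
    rw [← Fin.succ_last, Fin.cons_succ]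
    congr 1; funext c d
    rw [← Fin.cons_update, Fin.cons_snoc_eq_snoc_cons]

lemma sS_lin (D : HopfData H) (m : ℕ) (G : MultilinearMap ℂ (fun _ : Fin (m + 1) => H) V) :
    IsLinearMap ℂ (fun ω => sS D m ω G) := by
  induction m with
  | zero =>
    simp only [sS_zero]
    have hu : ∀ z x : H, Function.update (fun _ : Fin 1 => z) 0 x = fun _ => x := by
      intro z x; funext i; fin_cases i; simp
    constructor
    · intro x y
      have := G.map_update_add (fun _ => x) 0 x y
      simpa only [hu] using this
    · intro c x
      have := G.map_update_smul (fun _ => x) 0 c x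
      simpa only [hu] using this
  | succ m ih =>
    simp only [sS_succ_first]
    apply sΔ_lin
    · intro b
      constructor
      · intro x y
        have : ∀ v : Fin (m + 1) → H, G (Fin.cons (x + y) v) = G (Fin.cons x v) + G (Fin.cons y v) :=
          fun v => G.cons_add v x y
        simp only [this, sS, List.sum_map_add]
      · intro c x
        have : ∀ v : Fin (m + 1) → H, G (Fin.cons (c • x) v) = c • G (Fin.cons x v) :=
          fun v => G.cons_smul v c x
        simp only [this, sS, List.smul_sum, List.map_map, Function.comp_def]
    · intro a
      exact ih (G.curryLeft a)

lemma sS_add (D : HopfData H) (m : ℕ) (ω : H) (g g' : (Fin (m + 1) → H) → V) :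
    sS D m ω (fun v => g v + g' v) = sS D m ω g + sS D m ω g' := by
  simp only [sS, List.sum_map_add]

lemma sS_smul (D : HopfData H) (m : ℕ) (ω : H) (c : ℂ) (g : (Fin (m + 1) → H) → V) :
    sS D m ω (fun v => c • g v) = c • sS D m ω g := by
  simp only [sS, List.smul_sum, List.map_map, Function.comp_def]

lemma sS_sum {K : Type*} (s : Finset K) (D : HopfData H) (m : ℕ) (ω : H)
    (g : K → (Fin (m + 1) → H) → V) :
    sS D m ω (fun v => ∑ k ∈ s, g k v) = ∑ k ∈ s, sS D m ω (g k) := by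
  classical
  induction s using Finset.induction_on with
  | empty => simp [sS]
  | insert k s hk ih => simp [Finset.sum_insert hk, sS_add, ih]

lemma sS_coassoc (D : HopfData H) (m : ℕ) (ω : H)
    (G : MultilinearMap ℂ (fun _ : Fin (m + 2) => H) V) :
    sS D (m + 1) ω G = sΔ D ω (fun a b => sS D m a (fun v =>
      G (Fin.snoc (α := fun _ => H) v b))) := by
  induction m generalizing ω with
  | zero =>
    rw [sS_succ_first]
    simp only [sS_zero]
    congr 1; funext a b; congr 1
    funext i
    fin_cases i
    · change Fin.cons (α := fun _ => H) a _ 0 = Fin.snoc (α := fun _ => H) _ b (Fin.castSucc 0)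
      rw [Fin.snoc_castSucc]; rfl
    · change Fin.cons (α := fun _ => H) a _ (Fin.succ 0) = Fin.snoc (α := fun _ => H) _ b (Fin.last 1)
      rw [Fin.snoc_last, Fin.cons_succ]
  | succ m ih =>
    rw [sS_succ_first]
    have e : ∀ a b, sS D (m + 1) b (fun v => G (Fin.cons a v)) =
      sΔ D b (fun c d => sS D m c (fun v => G (Fin.cons a (Fin.snoc (α := fun _ => H) v d)))) :=
      fun a b => ih b (G.curryLeft a)
    simp only [e]
    rw [← sΔ_coassoc D ω (fun a c d => sS D m c
      (fun v => G (Fin.cons a (Fin.snoc (α := fun _ => H) v d))))]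
    · congr 1; funext a b
      rw [sS_succ_first]
      simp only [Fin.cons_snoc_eq_snoc_cons]
    · intro b c
      constructor
      · intro x y
        rw [← sS_add]; congr 1; funext v
        exact G.cons_add _ x y
      · intro r x
        rw [← sS_smul]; congr 1; funext v
        exact G.cons_smul _ r x
    · intro a d
      exact sS_lin D m ((LinearMap.applyₗ (R := ℂ) d).compMultilinearMap (G.curryLeft a).curryRight)
    · intro a c
      constructor
      · intro x y
        rw [← sS_add]; congr 1; funext v
        exact (G.curryLeft a).snoc_add _ x y
      · intro r x
        rw [← sS_smul]; congr 1; funext v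
        exact (G.curryLeft a).snoc_smul _ r x
end Iterated


section MatInv
variable {B : Type} [Ring B] [Algebra ℂ B]
variable {ι κ μ : Type} [Fintype ι] [DecidableEq ι] [Fintype κ] [DecidableEq κ]
  [Fintype μ] [DecidableEq μ]

/-- scalar matrices as matrices over `B` -/
def sc (B : Type) [Ring B] [Algebra ℂ B] (P : MRep H ι) : H →ₗ[ℂ] Matrix ι ι B :=
  (Algebra.linearMap ℂ B).mapMatrix ∘ₗ P.π

lemma sc_apply (P : MRep H ι) (ω : H) : sc B P ω = (P.π ω).map (algebraMap ℂ B) := rfl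

lemma sc_one (P : MRep H ι) : sc B P 1 = 1 := by
  rw [sc_apply, P.π_one]; simp

lemma sc_mul (P : MRep H ι) (a b : H) : sc B P (a * b) = sc B P b * sc B P a := by
  rw [sc_apply, P.π_mul, Matrix.map_mul]; rfl

/-- entrywise action -/
def aM (A : RAct H B) : H →ₗ[ℂ] Matrix κ ι B →ₗ[ℂ] Matrix κ ι B :=
  LinearMap.mk₂ ℂ (fun ω M => M.map (A.act ω))
    (by intros; ext; simp) (by intros; ext; simp) (by intros; ext; simp) (by intros; ext; simp)

lemma aM_apply (A : RAct H B) (ω : H) (M : Matrix κ ι B) : aM A ω M = M.map (A.act ω) := rfl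

lemma sΔ_entry (D : HopfData H) (ω : H) (g : H → H → Matrix κ ι B) (i : κ) (j : ι) :
    (sΔ D ω g) i j = sΔ D ω (fun a b => g a b i j) :=
  map_sΔ D ω g (Matrix.entryLinearMap ℂ B i j)

lemma sΔ_matmul (D : HopfData H) (ω : H) (g : H → H → Matrix κ ι B) (N : Matrix ι μ B) :
    (sΔ D ω g) * N = sΔ D ω (fun a b => g a b * N) :=
  map_sΔ D ω g (⟨⟨fun M => M * N, Matrix.zero_mul N⟩, fun M M' => Matrix.add_mul M M' N⟩ :
    Matrix κ ι B →+ Matrix κ μ B)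

lemma matmul_sΔ (D : HopfData H) (ω : H) (g : H → H → Matrix κ ι B) (N : Matrix μ κ B) :
    N * (sΔ D ω g) = sΔ D ω (fun a b => N * g a b) :=
  map_sΔ D ω g (⟨⟨fun M => N * M, Matrix.mul_zero N⟩, fun M M' => Matrix.mul_add N M M'⟩ :
    Matrix κ ι B →+ Matrix μ ι B)

lemma lin_matmul_right {V : Type*} [AddCommGroup V] [Module ℂ V] {h : V → Matrix κ ι B}
    (hh : IsLinearMap ℂ h) (N : Matrix ι μ B) : IsLinearMap ℂ (fun x => h x * N) :=
  ⟨fun x y => by simp only [hh.map_add, Matrix.add_mul],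
   fun c x => by simp only [hh.map_smul, Matrix.smul_mul]⟩

lemma lin_matmul_left {V : Type*} [AddCommGroup V] [Module ℂ V] {h : V → Matrix κ ι B}
    (N : Matrix μ κ B) (hh : IsLinearMap ℂ h) : IsLinearMap ℂ (fun x => N * h x) :=
  ⟨fun x y => by simp only [hh.map_add, Matrix.mul_add],
   fun c x => by simp only [hh.map_smul, Matrix.mul_smul]⟩

lemma lin_aM (A : RAct H B) (M : Matrix κ ι B) : IsLinearMap ℂ (fun a => aM A a M) :=
  ((aM A).flip M).isLinear

lemma lin_scS (D : HopfData H) (P : MRep H ι) : IsLinearMap ℂ (fun a => sc B P (D.Sinv a)) :=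
  (sc B P ∘ₗ D.Sinv).isLinear

/-- reformulated invariance -/
def MInv (D : HopfData H) (A : RAct H B) (P : MRep H ι) (Q : MRep H κ) (M : Matrix κ ι B) : Prop :=
  ∀ ω, sΔ D ω (fun a b => aM A a M * sc B P (D.Sinv b)) = sc B Q (D.Sinv ω) * M

lemma matActR_eq (D : HopfData H) (A : RAct H B) (P : MRep H ι) (Q : MRep H κ) (M : Matrix κ ι B)
    (ω : H) : matActR D P Q A ω M =
      sΔ D ω (fun a x => sΔ D x (fun b c => sc B Q a * aM A b M * sc B P (D.Sinv c))) := by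
  change sS D 2 ω (fun v => sc B Q (v 0) * aM A (v 1) M * sc B P (D.Sinv (v 2))) = _
  rw [sS_succ_first]
  congr 1; funext a x
  rw [sS_succ_first]
  congr 1; funext b c
  rw [sS_zero]; rfl

lemma MInv_of (D : HopfData H) (A : RAct H B) (P : MRep H ι) (Q : MRep H κ) (M : Matrix κ ι B)
    (h : ∀ ω : H, matActR D P Q A ω M = epsi ω • M) : MInv D A P Q M := by
  intro ω
  have h1 : sc B Q (D.Sinv ω) * M = sΔ D ω (fun a b => epsi b • (sc B Q (D.Sinv a) * M)) :=
    (sΔ_counit_right D ω (fun a => sc B Q (D.Sinv a) * M) (lin_matmul_right (lin_scS D Q) M)).symm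
  have h2 : ∀ a b, epsi b • (sc B Q (D.Sinv a) * M) = sΔ D b (fun c x => sΔ D x (fun d e =>
      sc B Q (D.Sinv a) * (sc B Q c * aM A d M * sc B P (D.Sinv e)))) := by
    intro a b
    rw [← Matrix.mul_smul, ← h b, matActR_eq]
    simp only [matmul_sΔ]
  rw [h1]
  simp only [h2]
  rw [← sΔ_4 D ω (fun a c d e => sc B Q (D.Sinv a) * (sc B Q c * aM A d M * sc B P (D.Sinv e)))
    (fun c d e => lin_matmul_right (lin_scS D Q) _)
    (fun a d e => lin_matmul_left _ (lin_matmul_right (lin_matmul_right (sc B Q).isLinear _) _))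
    (fun a c e => lin_matmul_left _ (lin_matmul_right (lin_matmul_left _ (lin_aM A M)) _))
    (fun a c d => lin_matmul_left _ (lin_matmul_left _ (lin_scS D P)))]
  have h3 : ∀ x y, (sΔ D x fun a c => sΔ D y fun d e =>
      sc B Q (D.Sinv a) * (sc B Q c * aM A d M * sc B P (D.Sinv e))) =
      epsi x • sΔ D y fun d e => aM A d M * sc B P (D.Sinv e) := by
    intro x y
    have : ∀ a c d e, sc B Q (D.Sinv a) * (sc B Q c * aM A d M * sc B P (D.Sinv e)) =
        sc B Q (c * D.Sinv a) * (aM A d M * sc B P (D.Sinv e)) := by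
      intro a c d e
      rw [sc_mul, Matrix.mul_assoc, Matrix.mul_assoc]
    simp only [this, ← matmul_sΔ]
    rw [← sΔ_matmul, ← map_sΔ, sΔ_Sinv_right, map_smul, sc_one, Matrix.smul_mul, Matrix.one_mul]
  simp only [h3]
  exact (sΔ_counit_left D ω (fun y => sΔ D y fun d e => aM A d M * sc B P (D.Sinv e))
    (sΔ_lin D _ (fun e => lin_matmul_right (lin_aM A M) _)
      (fun d => lin_matmul_left _ (lin_scS D P)))).symm

lemma aM_mul (D : HopfData H) (A : MAlg D B) (ω : H) (N : Matrix μ κ B) (M : Matrix κ ι B) :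
    aM A.toRAct ω (N * M) = sΔ D ω (fun a b => aM A.toRAct a N * aM A.toRAct b M) := by
  ext i j
  rw [sΔ_entry]
  simp only [aM_apply, Matrix.map_apply, Matrix.mul_apply, map_sum]
  rw [sΔ_sum]
  refine Finset.sum_congr rfl fun k _ => ?_
  rw [A.act_mul_mul]; rfl

lemma MInv_mul (D : HopfData H) (A : MAlg D B) (P : MRep H ι) (Q : MRep H κ) (R : MRep H μ)
    (N : Matrix μ κ B) (M : Matrix κ ι B) (hN : MInv D A.toRAct Q R N)
    (hM : MInv D A.toRAct P Q M) : MInv D A.toRAct P R (N * M) := by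
  intro ω
  simp only [aM_mul, sΔ_matmul]
  rw [sΔ_coassoc D ω (fun a b c => aM A.toRAct a N * aM A.toRAct b M * sc B P (D.Sinv c))
    (fun b c => lin_matmul_right (lin_matmul_right (lin_aM _ N) _) _)
    (fun b c => lin_matmul_right (lin_matmul_left _ (lin_aM _ M)) _)
    (fun b c => lin_matmul_left _ (lin_scS D P))]
  simp only [Matrix.mul_assoc, ← matmul_sΔ]
  simp only [hM _]
  simp only [← Matrix.mul_assoc, ← sΔ_matmul]
  rw [hN]

lemma MInv_one (D : HopfData H) (A : MAlg D B) (P : MRep H ι) : MInv D A.toRAct P P 1 := by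
  intro ω
  have : ∀ a, aM A.toRAct a (1 : Matrix ι ι B) = epsi a • 1 := by
    intro a
    ext i j
    rw [aM_apply, Matrix.map_apply, Matrix.smul_apply]
    by_cases h : i = j
    · subst h; simp [A.act_algOne]
    · simp [h]
  simp only [this, Matrix.smul_mul, Matrix.one_mul, Matrix.mul_one]
  exact sΔ_counit_left D ω (fun b => sc B P (D.Sinv b)) (lin_scS D P)

lemma MInv_zero (D : HopfData H) (A : RAct H B) (P : MRep H ι) (Q : MRep H κ) :
    MInv D A P Q 0 := by
  intro ω
  simp [sΔ]

lemma MInv_add (D : HopfData H) (A : RAct H B) (P : MRep H ι) (Q : MRep H κ)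
    (M N : Matrix κ ι B) (hM : MInv D A P Q M) (hN : MInv D A P Q N) : MInv D A P Q (M + N) := by
  intro ω
  simp only [map_add, Matrix.add_mul, Matrix.mul_add, sΔ_add]
  rw [hM, hN]

lemma MInv_smul (D : HopfData H) (A : RAct H B) (P : MRep H ι) (Q : MRep H κ)
    (c : ℂ) (M : Matrix κ ι B) (hM : MInv D A P Q M) : MInv D A P Q (c • M) := by
  intro ω
  simp only [map_smul, Matrix.smul_mul, Matrix.mul_smul, sΔ_smul]
  rw [hM]

lemma MInv_neg (D : HopfData H) (A : RAct H B) (P : MRep H ι) (Q : MRep H κ)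
    (M : Matrix κ ι B) (hM : MInv D A P Q M) : MInv D A P Q (-M) := by
  have := MInv_smul D A P Q (-1) M hM
  simpa using this

lemma MInv_inv (D : HopfData H) (A : MAlg D B) (P : MRep H ι) (u u' : Matrix ι ι B)
    (h1 : u * u' = 1) (h2 : u' * u = 1) (hu : MInv D A.toRAct P P u) :
    MInv D A.toRAct P P u' := by
  intro ω
  have e := MInv_one D A P ω
  rw [← h2] at e
  simp only [aM_mul, sΔ_matmul] at e
  rw [sΔ_coassoc D ω (fun a b c => aM A.toRAct a u' * aM A.toRAct b u * sc B P (D.Sinv c))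
    (fun b c => lin_matmul_right (lin_matmul_right (lin_aM _ _) _) _)
    (fun b c => lin_matmul_right (lin_matmul_left _ (lin_aM _ _)) _)
    (fun b c => lin_matmul_left _ (lin_scS D P))] at e
  simp only [Matrix.mul_assoc, ← matmul_sΔ] at e
  simp only [hu _] at e
  simp only [← Matrix.mul_assoc, ← sΔ_matmul] at e
  have e2 := congrArg (· * u') e
  simp only [Matrix.mul_assoc, h1, Matrix.mul_one] at e2
  exact e2

/-- the algebra of invariants -/
def invAlg (D : HopfData H) (A : MAlg D B) (P : MRep H ι) : Subalgebra ℂ (Matrix ι ι B) where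
  carrier := {M | MInv D A.toRAct P P M}
  mul_mem' := fun hM hN => MInv_mul D A P P P _ _ hM hN
  add_mem' := fun hM hN => MInv_add D _ P P _ _ hM hN
  algebraMap_mem' := fun c => by
    rw [Algebra.algebraMap_eq_smul_one]
    exact MInv_smul D _ P P c 1 (MInv_one D A P)

/-- direct sum of modules -/
def MRep.dsum (P : MRep H ι) (Q : MRep H κ) : MRep H (ι ⊕ κ) where
  π := { toFun := fun ω => Matrix.fromBlocks (P.π ω) 0 0 (Q.π ω)
         map_add' := fun x y => by simp [Matrix.fromBlocks_add]
         map_smul' := fun c x => by simp [Matrix.fromBlocks_smul] }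
  π_one := by simp [P.π_one, Q.π_one]
  π_mul := fun x y => by simp [P.π_mul, Q.π_mul, Matrix.fromBlocks_multiply]

lemma MInv_blocks (D : HopfData H) (A : RAct H B) (P : MRep H ι) (Q : MRep H κ)
    (R : MRep H (ι ⊕ κ)) (hR : ∀ ω : H, R.π ω = Matrix.fromBlocks (P.π ω) 0 0 (Q.π ω))
    (a : Matrix ι ι B) (b : Matrix ι κ B) (c : Matrix κ ι B) (d : Matrix κ κ B)
    (ha : MInv D A P P a) (hb : MInv D A Q P b) (hc : MInv D A P Q c) (hd : MInv D A Q Q d) :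
    MInv D A R R (Matrix.fromBlocks a b c d) := by
  intro ω
  have h1 : ∀ ω, sc B R ω = Matrix.fromBlocks (sc B P ω) 0 0 (sc B Q ω) := by
    intro ω
    simp [sc_apply, hR, Matrix.fromBlocks_map]
  have h2 : ∀ ω, aM A ω (Matrix.fromBlocks a b c d) =
      Matrix.fromBlocks (aM A ω a) (aM A ω b) (aM A ω c) (aM A ω d) := by
    intro ω
    simp [aM_apply, Matrix.fromBlocks_map]
  simp only [h1, h2, Matrix.fromBlocks_multiply, Matrix.mul_zero, Matrix.zero_mul, add_zero,
    zero_add]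
  rw [← ha, ← hb, ← hc, ← hd]
  ext i j
  rw [sΔ_entry]
  rcases i with i | i <;> rcases j with j | j <;>
    simp only [Matrix.fromBlocks_apply₁₁, Matrix.fromBlocks_apply₁₂, Matrix.fromBlocks_apply₂₁,
      Matrix.fromBlocks_apply₂₂, sΔ_entry]
end MatInv


section Psi
variable {B : Type} [Ring B] [Algebra ℂ B]
variable {ι κ : Type} [Fintype ι] [DecidableEq ι] [Fintype κ] [DecidableEq κ]

/-- bundle a multilinear cochain -/
def toF {n : ℕ} (f : Raw H B n) (hf : IsML f) :
    H →ₗ[ℂ] MultilinearMap ℂ (fun _ : Fin (n + 1) => B) ℂ where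
  toFun ω :=
    { toFun := f ω
      map_update_add' := by
        intro inst b i x y
        rw [Subsingleton.elim inst (instDecidableEqFin (n + 1))]
        exact hf.2.2.1 ω b i x y
      map_update_smul' := by
        intro inst b i c x
        rw [Subsingleton.elim inst (instDecidableEqFin (n + 1))]
        exact hf.2.2.2 ω b i c x }
  map_add' := fun x y => by ext b; exact hf.1 x y b
  map_smul' := fun c x => by ext b; exact hf.2.1 c x b

lemma toF_apply {n : ℕ} (f : Raw H B n) (hf : IsML f) (ω : H) (b : Fin (n + 1) → B) :
    toF f hf ω b = f ω b := rfl

/-- trace extension of a multilinear functional -/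
def trM {m : ℕ} (Y : Matrix ι ι ℂ) (F : MultilinearMap ℂ (fun _ : Fin m => B) ℂ) :
    MultilinearMap ℂ (fun _ : Fin m => Matrix ι ι B) ℂ :=
  ∑ k : Fin (m + 1) → ι, Y (k (Fin.last m)) (k 0) •
    F.compLinearMap (fun i => Matrix.entryLinearMap ℂ B (k i.castSucc) (k i.succ))

lemma trM_apply {m : ℕ} (Y : Matrix ι ι ℂ) (F : MultilinearMap ℂ (fun _ : Fin m => B) ℂ)
    (M : Fin m → Matrix ι ι B) : trM Y F M = ∑ k : Fin (m + 1) → ι, Y (k (Fin.last m)) (k 0) *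
      F (fun i => M i (k i.castSucc) (k i.succ)) := by
  simp [trM]

lemma lin_trM_Y {m : ℕ} (F : MultilinearMap ℂ (fun _ : Fin m => B) ℂ) :
    IsLinearMap ℂ (fun Y : Matrix ι ι ℂ => trM Y F) := by
  constructor
  · intro x y; refine MultilinearMap.ext fun M => ?_; simp [trM_apply, add_mul, Finset.sum_add_distrib]
  · intro c x; refine MultilinearMap.ext fun M => ?_; simp [trM_apply, mul_assoc, Finset.mul_sum]

lemma lin_trM_F {m : ℕ} (Y : Matrix ι ι ℂ) :
    IsLinearMap ℂ (fun F : MultilinearMap ℂ (fun _ : Fin m => B) ℂ => trM Y F) := by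
  constructor
  · intro x y; refine MultilinearMap.ext fun M => ?_; simp [trM_apply, mul_add, Finset.sum_add_distrib]
  · intro c x; refine MultilinearMap.ext fun M => ?_; simp [trM_apply, mul_left_comm, Finset.mul_sum]

/-- the bundled `Ψ` -/
def PsiM (D : HopfData H) (P : MRep H ι) {m : ℕ}
    (F : H →ₗ[ℂ] MultilinearMap ℂ (fun _ : Fin m => B) ℂ) (ω : H) :
    MultilinearMap ℂ (fun _ : Fin m => Matrix ι ι B) ℂ :=
  sΔ D ω (fun a b => trM (P.π (D.Sinv b)) (F a))

lemma PsiM_lin (D : HopfData H) (P : MRep H ι) {m : ℕ}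
    (F : H →ₗ[ℂ] MultilinearMap ℂ (fun _ : Fin m => B) ℂ) : IsLinearMap ℂ (PsiM D P F) :=
  sΔ_lin D _ (fun b => lin_comp (lin_trM_F (P.π (D.Sinv b))) F.isLinear)
    (fun a => lin_comp (g := fun Y => trM Y (F a)) (lin_trM_Y (F a)) (P.π ∘ₗ D.Sinv).isLinear)

lemma PsiM_apply (D : HopfData H) (P : MRep H ι) {m : ℕ}
    (F : H →ₗ[ℂ] MultilinearMap ℂ (fun _ : Fin m => B) ℂ) (ω : H) (M : Fin m → Matrix ι ι B) :
    PsiM D P F ω M = sΔ D ω (fun a b => trM (P.π (D.Sinv b)) (F a) M) :=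
  map_sΔ D ω (fun a b => trM (P.π (D.Sinv b)) (F a))
    (⟨⟨fun φ => φ M, rfl⟩, fun _ _ => rfl⟩ :
      MultilinearMap ℂ (fun _ : Fin m => Matrix ι ι B) ℂ →+ ℂ)

lemma PsiRaw_eq (D : HopfData H) (P : MRep H ι) {n : ℕ} (f : Raw H B n) (hf : IsML f) (ω : H)
    (M : Fin (n + 1) → Matrix ι ι B) : PsiRaw D P f ω M = PsiM D P (toF f hf) ω M := by
  rw [PsiM_apply]
  simp only [trM_apply]
  rfl

/-- contraction commutes with traces -/
lemma tr_contract {n : ℕ} (Y : Matrix ι ι ℂ) (F : MultilinearMap ℂ (fun _ : Fin (n + 1) => B) ℂ)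
    (i : Fin (n + 1)) (M : Fin (n + 2) → Matrix ι ι B) :
    ∑ k : Fin (n + 3) → ι, Y (k (Fin.last (n + 2))) (k 0) *
      F (contract i fun j => M j (k j.castSucc) (k j.succ)) = trM Y F (contract i M) := by
  rw [trM_apply, ← (Fin.insertNthEquiv (fun _ : Fin (n + 3) => ι) i.succ.castSucc).sum_comp,
    Fintype.sum_prod_type, Finset.sum_comm]
  refine Finset.sum_congr rfl fun k _ => ?_
  have e1 : ∀ l, Fin.insertNthEquiv (fun _ : Fin (n + 3) => ι) i.succ.castSucc (l, k) =
      Fin.insertNth (α := fun _ => ι) i.succ.castSucc l k := fun _ => rfl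
  have e2 : ∀ l x, Fin.insertNth (α := fun _ => ι) i.succ.castSucc l k
      (i.succ.castSucc.succAbove x) = k x := fun l x => by simp
  have a0 : (0 : Fin (n + 3)) = i.succ.castSucc.succAbove 0 := by
    rw [Fin.succAbove_of_castSucc_lt]; rfl; simp [Fin.lt_def]
  have a1 : (Fin.last (n + 2) : Fin (n + 3)) = i.succ.castSucc.succAbove (Fin.last _) := by
    rw [Fin.succAbove_of_le_castSucc]; rfl
    simp only [Fin.le_def, Fin.val_castSucc, Fin.val_succ, Fin.val_last]; omega
  have e3 : (fun j => contract i M j (k j.castSucc) (k j.succ)) =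
      Function.update (fun j => contract i M j (k j.castSucc) (k j.succ)) i
        (∑ l, M i.castSucc (k i.castSucc) l * M i.succ l (k i.succ)) := by
    rw [eq_comm, Function.update_eq_self_iff]
    simp [contract, Matrix.mul_apply]
  rw [e3, MultilinearMap.map_update_sum, Finset.mul_sum]
  refine Finset.sum_congr rfl fun l _ => ?_
  rw [e1]
  have b0 : Fin.insertNth (α := fun _ => ι) i.succ.castSucc l k 0 = k 0 := by
    conv_lhs => rw [a0]
    exact e2 l 0
  have b1 : Fin.insertNth (α := fun _ => ι) i.succ.castSucc l k (Fin.last (n + 2))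
      = k (Fin.last (n + 1)) := by
    conv_lhs => rw [a1]
    exact e2 l _
  rw [b0, b1]
  congr 2
  funext j
  have c1 : ∀ j : Fin (n + 1), j ≤ i → Fin.insertNth (α := fun _ => ι) i.succ.castSucc l k
      j.castSucc.castSucc = k j.castSucc := by
    intro j hj
    rw [← e2 l j.castSucc, Fin.succAbove_of_castSucc_lt]
    simp only [Fin.lt_def, Fin.le_def, Fin.val_castSucc, Fin.val_succ] at *; omega
  have c2 : ∀ j : Fin (n + 1), j < i → Fin.insertNth (α := fun _ => ι) i.succ.castSucc l k
      j.succ.castSucc = k j.succ := by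
    intro j hj
    rw [← e2 l j.succ, Fin.succAbove_of_castSucc_lt]
    simp only [Fin.lt_def, Fin.le_def, Fin.val_castSucc, Fin.val_succ] at *; omega
  have c3 : ∀ j : Fin (n + 1), i < j → Fin.insertNth (α := fun _ => ι) i.succ.castSucc l k
      j.succ.castSucc = k j.castSucc := by
    intro j hj
    rw [← Fin.succ_castSucc j, ← e2 l j.castSucc, Fin.succAbove_of_le_castSucc]
    simp only [Fin.lt_def, Fin.le_def, Fin.val_castSucc, Fin.val_succ] at *; omega
  have c4 : ∀ j : Fin (n + 1), i ≤ j → Fin.insertNth (α := fun _ => ι) i.succ.castSucc l k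
      j.succ.succ = k j.succ := by
    intro j hj
    rw [← e2 l j.succ, Fin.succAbove_of_le_castSucc]
    simp only [Fin.lt_def, Fin.le_def, Fin.val_castSucc, Fin.val_succ] at *; omega
  have c5 : Fin.insertNth (α := fun _ => ι) i.succ.castSucc l k i.succ.castSucc = l := by simp
  rcases lt_trichotomy j i with h | h | h
  · have h' : (j : ℕ) < i := h
    rw [Function.update_of_ne h.ne]
    simp only [contract, h', if_true]
    rw [c1 j h.le, Fin.succ_castSucc, c2 j h]
  · subst h
    simp only [contract, Function.update_self, lt_irrefl, if_false, if_true]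
    rw [c1 j le_rfl, c4 j le_rfl, Fin.succ_castSucc, c5]
  · have h' : ¬ (j : ℕ) < i := not_lt.2 (Fin.le_def.1 h.le)
    have h'' : ¬ (j : ℕ) = i := fun e => h.ne' (Fin.ext e)
    rw [Function.update_of_ne h.ne']
    simp only [contract, h', h'', if_false]
    rw [c3 j h, c4 j h.le]

lemma Psi_contract (D : HopfData H) (P : MRep H ι) {n : ℕ} (f : Raw H B n) (hf : IsML f)
    (i : Fin (n + 1)) (ω : H) (M : Fin (n + 2) → Matrix ι ι B) :
    PsiRaw D P (fun ω b => f ω (contract i b)) ω M = PsiM D P (toF f hf) ω (contract i M) := by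
  rw [PsiM_apply]
  simp only [← tr_contract]
  rfl

lemma Psi_blocks (D : HopfData H) (P : MRep H ι) (Q : MRep H κ)
    (R : MRep H (ι ⊕ κ)) (hR : ∀ ω : H, R.π ω = Matrix.fromBlocks (P.π ω) 0 0 (Q.π ω))
    {m : ℕ} (F : H →ₗ[ℂ] MultilinearMap ℂ (fun _ : Fin (m + 1) => B) ℂ) (ω : H)
    (a : Fin (m + 1) → Matrix ι ι B) (d : Fin (m + 1) → Matrix κ κ B) :
    PsiM D R F ω (fun i => Matrix.fromBlocks (a i) 0 0 (d i)) =
      PsiM D P F ω a + PsiM D Q F ω d := by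
  simp only [PsiM_apply]
  rw [← sΔ_add]
  congr 1
  funext x y
  simp only [trM_apply, hR]
  have hs := Fintype.sum_sum_type (f := fun s : (Fin (m + 2) → ι) ⊕ (Fin (m + 2) → κ) =>
    Sum.elim (fun k => (P.π (D.Sinv y)) (k (Fin.last (m + 1))) (k 0) *
      (F x) fun i => a i (k i.castSucc) (k i.succ))
     (fun k => (Q.π (D.Sinv y)) (k (Fin.last (m + 1))) (k 0) *
      (F x) fun i => d i (k i.castSucc) (k i.succ)) s)
  simp only [Sum.elim_inl, Sum.elim_inr] at hs
  rw [← hs]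
  symm
  refine Fintype.sum_of_injective (fun s : (Fin (m + 2) → ι) ⊕ (Fin (m + 2) → κ) =>
    Sum.elim (fun k i => (Sum.inl (k i) : ι ⊕ κ)) (fun k i => Sum.inr (k i)) s) ?_ _ _ ?_ ?_
  · rintro (k | k) (k' | k') h
    · congr 1; funext i; simpa using congrFun h i
    · simpa using congrFun h 0
    · simpa using congrFun h 0
    · congr 1; funext i; simpa using congrFun h i
  · intro k hk
    by_cases hm : ∀ i : Fin (m + 1), (k i.castSucc).isLeft = (k i.succ).isLeft
    · exfalso
      have hc : ∀ i : Fin (m + 2), (k i).isLeft = (k 0).isLeft := by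
        intro i
        induction i using Fin.induction with
        | zero => rfl
        | succ i ih => rw [← hm, ih]
      apply hk
      rcases h0 : k 0 with z | z
      · have : ∀ i, ∃ x, k i = Sum.inl x := by
          intro i; exact Sum.isLeft_iff.1 (by rw [hc, h0]; rfl)
        choose x hx using this
        exact ⟨Sum.inl x, funext fun i => (hx i).symm⟩
      · have : ∀ i, ∃ x, k i = Sum.inr x := by
          intro i
          have := hc i
          rw [h0] at this
          rcases hi : k i with w | w
          · rw [hi] at this; simp at this
          · exact ⟨w, rfl⟩
        choose x hx using this
        exact ⟨Sum.inr x, funext fun i => (hx i).symm⟩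
    · push Not at hm
      obtain ⟨i, hi⟩ := hm
      rw [MultilinearMap.map_coord_zero (F x) i, mul_zero]
      rcases h1 : k i.castSucc with z | z <;> rcases h2 : k i.succ with w | w <;>
        rw [h1, h2] at hi <;> simp at hi ⊢
  · rintro (k | k) <;> simp

end Psi


section PsiCyc
variable {B : Type} [Ring B] [Algebra ℂ B]
variable {ι κ : Type} [Fintype ι] [DecidableEq ι] [Fintype κ] [DecidableEq κ]

/-- auxiliary functional: insert a matrix entry in the first slot -/
def fstL {n : ℕ} (G : MultilinearMap ℂ (fun _ : Fin (n + 1) => B) ℂ) (r : Fin n → B) (i j : ι) :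
    Matrix ι ι B →ₗ[ℂ] ℂ where
  toFun X := G (Fin.cons (α := fun _ => B) (X i j) r)
  map_add' := fun X Y => by rw [Matrix.add_apply]; exact G.cons_add r _ _
  map_smul' := fun c X => by rw [Matrix.smul_apply]; exact G.cons_smul r _ _

lemma fstL_apply {n : ℕ} (G : MultilinearMap ℂ (fun _ : Fin (n + 1) => B) ℂ) (r : Fin n → B)
    (i j : ι) (X : Matrix ι ι B) :
    fstL G r i j X = G (Fin.cons (α := fun _ => B) (X i j) r) := rfl

lemma fstL_mul_sc {n : ℕ} (G : MultilinearMap ℂ (fun _ : Fin (n + 1) => B) ℂ) (r : Fin n → B)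
    (i j : ι) (X : Matrix ι ι B) (P : MRep H ι) (y : H) :
    fstL G r i j (X * sc B P y) =
      ∑ l, P.π y l j * G (Fin.cons (α := fun _ => B) (X i l) r) := by
  have : (X * sc B P y) i j = ∑ l, P.π y l j • X i l := by
    rw [Matrix.mul_apply]
    refine Finset.sum_congr rfl fun l _ => ?_
    rw [sc_apply, Matrix.map_apply, ← Algebra.commutes, Algebra.smul_def]
  have e : fstL G r i j (X * sc B P y) = G.curryLeft ((X * sc B P y) i j) r := rfl
  rw [e, this, map_sum]
  simp

lemma fstL_sc_mul {n : ℕ} (G : MultilinearMap ℂ (fun _ : Fin (n + 1) => B) ℂ) (r : Fin n → B)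
    (i j : ι) (X : Matrix ι ι B) (P : MRep H ι) (y : H) :
    fstL G r i j (sc B P y * X) =
      ∑ l, P.π y i l * G (Fin.cons (α := fun _ => B) (X l j) r) := by
  have : (sc B P y * X) i j = ∑ l, P.π y i l • X l j := by
    rw [Matrix.mul_apply]
    refine Finset.sum_congr rfl fun l _ => ?_
    rw [sc_apply, Matrix.map_apply, Algebra.smul_def]
  have e : fstL G r i j (sc B P y * X) = G.curryLeft ((sc B P y * X) i j) r := rfl
  rw [e, this, map_sum]
  simp

lemma lin_fstL {n : ℕ} (r : Fin n → B) (i j : ι) (X : Matrix ι ι B) :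
    IsLinearMap ℂ (fun G : MultilinearMap ℂ (fun _ : Fin (n + 1) => B) ℂ => fstL G r i j X) :=
  ⟨fun _ _ => rfl, fun _ _ => rfl⟩

lemma lin_fsum {U V K : Type*} [AddCommGroup U] [Module ℂ U] [AddCommGroup V] [Module ℂ V]
    (s : Finset K) (g : K → U → V) (h : ∀ k, IsLinearMap ℂ (g k)) :
    IsLinearMap ℂ (fun u => ∑ k ∈ s, g k u) := by
  constructor
  · intro x y; simp only [(h _).map_add, Finset.sum_add_distrib]
  · intro c x; simp only [(h _).map_smul, Finset.smul_sum]

lemma Psi_cyc (D : HopfData H) (A : MAlg D B) (P : MRep H ι) {n : ℕ} (f : Raw H B n) (hf : IsML f)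
    (ω : H) (M : Fin (n + 1) → Matrix ι ι B) (hM : MInv D A.toRAct P P (M (Fin.last n))) :
    PsiRaw D P (tRaw D A.fn f) ω M = PsiM D P (toF f hf) ω
      (Fin.cons (α := fun _ => Matrix ι ι B) (M (Fin.last n)) fun i : Fin n => M i.castSucc) := by
  set r : (Fin (n + 1) → ι) → Fin n → B := fun k i => M i.castSucc (k i.castSucc) (k i.succ) with hr
  have h1 : PsiRaw D P (tRaw D A.fn f) ω M = sΔ D ω (fun x y => sΔ D x (fun a b =>
      ∑ k : Fin (n + 1) → ι, fstL (toF f hf a) (r k) (k (Fin.last n)) (k 0)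
        (aM A.toRAct b (M (Fin.last n)) * sc B P (D.Sinv y)))) := by
    change sΔ D ω (fun x y => ∑ k : Fin (n + 2) → ι, P.π (D.Sinv y) (k (Fin.last (n + 1))) (k 0) *
      sΔ D x (fun a b => toF f hf a (Fin.cons (α := fun _ => B)
        (A.act b (M (Fin.last n) (k (Fin.last n).castSucc) (k (Fin.last n).succ)))
          fun i : Fin n => M i.castSucc (k i.castSucc.castSucc) (k i.castSucc.succ)))) = _
    congr 1; funext x y
    rw [← (Fin.snocEquiv (fun _ : Fin (n + 2) => ι)).sum_comp, Fintype.sum_prod_type,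
      Finset.sum_comm, sΔ_sum]
    refine Finset.sum_congr rfl fun k _ => ?_
    simp only [fstL_mul_sc]
    rw [sΔ_sum]
    refine Finset.sum_congr rfl fun l _ => ?_
    rw [← smul_eq_mul, ← sΔ_smul]
    have e : Fin.snocEquiv (fun _ : Fin (n + 2) => ι) (l, k) =
      Fin.snoc (α := fun _ => ι) k l := rfl
    have e0 : (Fin.snoc (α := fun _ => ι) k l : Fin (n + 2) → ι) 0 = k 0 :=
      Fin.snoc_castSucc (α := fun _ => ι) l k 0
    have e1 : ∀ i, (Fin.snoc (α := fun _ => ι) k l : Fin (n + 2) → ι) (Fin.castSucc i) = k i :=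
      fun i => Fin.snoc_castSucc (α := fun _ => ι) l k i
    have e2 : (Fin.snoc (α := fun _ => ι) k l : Fin (n + 2) → ι) (Fin.last _) = l :=
      Fin.snoc_last (α := fun _ => ι) l k
    simp only [e, e0, e1, e2, Fin.succ_castSucc, Fin.succ_last, smul_eq_mul, hr, aM_apply,
      Matrix.map_apply]
  rw [h1, sΔ_coassoc D ω (fun a b y => ∑ k : Fin (n + 1) → ι,
      fstL (toF f hf a) (r k) (k (Fin.last n)) (k 0)
        (aM A.toRAct b (M (Fin.last n)) * sc B P (D.Sinv y)))
      (fun b y => lin_fsum _ _ fun k => lin_comp (lin_fstL _ _ _ _) (toF f hf).isLinear)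
      (fun a y => lin_fsum _ _ fun k => lin_comp (LinearMap.isLinear _)
        (lin_matmul_right (lin_aM _ _) _))
      (fun a b => lin_fsum _ _ fun k => lin_comp (LinearMap.isLinear _)
        (lin_matmul_left _ (lin_scS D P)))]
  rw [PsiM_apply]
  congr 1; funext a x
  rw [sΔ_sum]
  simp only [← map_sΔ, hM _, fstL_sc_mul]
  rw [trM_apply, ← (Fin.consEquiv (fun _ : Fin (n + 2) => ι)).sum_comp, Fintype.sum_prod_type,
      Finset.sum_comm]
  refine Finset.sum_congr rfl fun l _ => Finset.sum_congr rfl fun k _ => ?_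
  have e : Fin.consEquiv (fun _ : Fin (n + 2) => ι) (l, k) =
      Fin.cons (α := fun _ => ι) l k := rfl
  rw [e]
  have e2 : (Fin.cons (α := fun _ => ι) l k : Fin (n + 2) → ι) (Fin.last (n + 1)) =
    k (Fin.last n) := by
    rw [← Fin.succ_last]; exact Fin.cons_succ _ _ _
  rw [e2]
  congr 2
  funext i
  refine Fin.cases ?_ (fun i => ?_) i
  · rfl
  · simp only [Fin.cons_succ, hr]
    rw [← Fin.succ_castSucc]; rfl

end PsiCyc


section Move
variable {B : Type} [Ring B] [Algebra ℂ B]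
variable {ι κ : Type} [Fintype ι] [DecidableEq ι] [Fintype κ] [DecidableEq κ]

/-- act on all arguments -/
def actF (A : RAct H B) {m : ℕ} (F : MultilinearMap ℂ (fun _ : Fin m => B) ℂ) (v : Fin m → H) :
    MultilinearMap ℂ (fun _ : Fin m => B) ℂ := F.compLinearMap fun i => A.act (v i)

lemma actF_apply (A : RAct H B) {m : ℕ} (F : MultilinearMap ℂ (fun _ : Fin m => B) ℂ)
    (v : Fin m → H) (b : Fin m → B) : actF A F v b = F (fun i => A.act (v i) (b i)) := rfl

lemma trM_cons {m : ℕ} (Y : Matrix ι ι ℂ) (F : MultilinearMap ℂ (fun _ : Fin (m + 1) => B) ℂ)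
    (M : Fin (m + 1) → Matrix ι ι B) : trM Y F M =
      ∑ k : Fin (m + 1) → ι, ∑ j, Y (k (Fin.last m)) j *
        F (Fin.cons (α := fun _ => B) (M 0 j (k 0))
          fun i => M i.succ (k i.castSucc) (k i.succ)) := by
  rw [trM_apply, ← (Fin.consEquiv (fun _ : Fin (m + 2) => ι)).sum_comp, Fintype.sum_prod_type,
      Finset.sum_comm]
  refine Finset.sum_congr rfl fun k _ => Finset.sum_congr rfl fun l _ => ?_
  have e : Fin.consEquiv (fun _ : Fin (m + 2) => ι) (l, k) =
      Fin.cons (α := fun _ => ι) l k := rfl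
  rw [e]
  have e2 : (Fin.cons (α := fun _ => ι) l k : Fin (m + 2) → ι) (Fin.last (m + 1)) =
    k (Fin.last m) := by
    rw [← Fin.succ_last]; exact Fin.cons_succ _ _ _
  rw [e2]
  congr 2
  funext i
  refine Fin.cases ?_ (fun i => ?_) i
  · rfl
  · simp only [Fin.cons_succ]
    rw [← Fin.succ_castSucc]; rfl

lemma trM_move (D : HopfData H) (A : RAct H B) (P : MRep H ι) {m : ℕ}
    (F : MultilinearMap ℂ (fun _ : Fin m => B) ℂ) (M : Fin m → Matrix ι ι B)
    (hM : ∀ i, MInv D A P P (M i)) (Y : Matrix ι ι ℂ) (ω : H) :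
    trM (Y * P.π (D.Sinv ω)) F M = sS D m ω (fun v =>
      trM (P.π (D.Sinv (v (Fin.last m))) * Y) (actF A F fun i => v i.castSucc) M) := by
  induction m generalizing ω Y with
  | zero =>
    rw [sS_zero]
    have e : ∀ (X : Matrix ι ι ℂ) (G : MultilinearMap ℂ (fun _ : Fin 0 => B) ℂ),
        trM X G M = X.trace * G Fin.elim0 := by
      intro X G
      rw [trM_apply, ← (Equiv.funUnique (Fin 1) ι).symm.sum_comp, Matrix.trace, Finset.sum_mul]
      refine Finset.sum_congr rfl fun i _ => ?_
      congr 2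
      funext i; exact i.elim0
    rw [e, e, Matrix.trace_mul_comm, actF_apply]
    congr 2
    funext i; exact i.elim0
  | succ m ih =>
    set r : (Fin (m + 1) → ι) → Fin m → B :=
      fun k i => M i.succ (k i.castSucc) (k i.succ) with hr
    have s1 : trM (Y * P.π (D.Sinv ω)) F M =
        ∑ k : Fin (m + 1) → ι, ∑ j, Y (k (Fin.last m)) j •
          fstL F (r k) j (k 0) (sc B P (D.Sinv ω) * M 0) := by
      rw [trM_cons]
      refine Finset.sum_congr rfl fun k _ => ?_
      simp only [fstL_sc_mul, Matrix.mul_apply, Finset.sum_mul, Finset.smul_sum, smul_eq_mul,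
        mul_assoc, Finset.mul_sum]
      rw [Finset.sum_comm]
    have s2 : trM (Y * P.π (D.Sinv ω)) F M = sΔ D ω (fun a b =>
        ∑ j, ∑ l, trM (Matrix.of (fun s t => if t = l then Y s j else 0) * P.π (D.Sinv b))
          (F.curryLeft (A.act a (M 0 j l))) (fun i => M i.succ)) := by
      rw [s1]
      simp only [← hM 0 ω, map_sΔ, ← sΔ_smul, ← sΔ_sum]
      congr 1; funext a b
      simp only [fstL_mul_sc, trM_apply]
      rw [Finset.sum_comm]
      refine Finset.sum_congr rfl fun j _ => ?_
      rw [Finset.sum_comm]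
      refine Finset.sum_congr rfl fun k _ => ?_
      rw [Finset.smul_sum]
      refine Finset.sum_congr rfl fun l _ => ?_
      simp only [Matrix.mul_apply, Matrix.of_apply, ite_mul, zero_mul, Finset.sum_ite_eq',
        Finset.mem_univ, if_true, smul_eq_mul, mul_assoc]
      rfl
    rw [s2, sS_succ_first]
    congr 1; funext a b
    simp only [ih _ (fun i => M i.succ) (fun i => hM i.succ)]
    simp only [← sS_sum]
    congr 1; funext v
    rw [trM_cons]
    simp only [trM_apply]
    conv_rhs => rw [Finset.sum_comm]
    refine Finset.sum_congr rfl fun j _ => ?_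
    rw [Finset.sum_comm]
    refine Finset.sum_congr rfl fun k _ => ?_
    rw [Finset.sum_eq_single (k 0)]
    · have e0 : (Fin.cons (α := fun _ => H) a v : Fin (m + 2) → H) (Fin.last (m + 1)) =
        v (Fin.last m) := by
        rw [← Fin.succ_last]; exact Fin.cons_succ _ _ _
      rw [e0]
      congr 1
      · simp [Matrix.mul_apply]
      · rw [actF_apply, actF_apply, MultilinearMap.curryLeft_apply]
        congr 1
        funext i
        refine Fin.cases ?_ (fun i => ?_) i
        · rfl
        · simp only [Fin.cons_succ]
          rw [← Fin.succ_castSucc]; rfl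
    · intro l _ hl
      have : (P.π (D.Sinv (v (Fin.last m))) *
          Matrix.of (fun s t => if t = l then Y s j else 0)) (k (Fin.last m)) (k 0) = 0 := by
        rw [Matrix.mul_apply]
        refine Finset.sum_eq_zero fun x _ => ?_
        rw [Matrix.of_apply, if_neg (Ne.symm hl), mul_zero]
      rw [this, zero_mul]
    · intro h; exact absurd (Finset.mem_univ _) h

/-- the multilinear map `v ↦ tr(π(S⁻¹ v_last) Y)(F ∘ act v)` -/
def moveG (D : HopfData H) (A : RAct H B) (P : MRep H ι) {m : ℕ}
    (F : MultilinearMap ℂ (fun _ : Fin m => B) ℂ) (M : Fin m → Matrix ι ι B) (Y : Matrix ι ι ℂ) :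
    MultilinearMap ℂ (fun _ : Fin (m + 1) => H) ℂ :=
  ∑ k : Fin (m + 1) → ι, MultilinearMap.uncurryRight (M := fun _ => H)
    ((F.compLinearMap fun i => A.act.flip (M i (k i.castSucc) (k i.succ))).smulRight
      ((Matrix.entryLinearMap ℂ ℂ (k (Fin.last m)) (k 0)) ∘ₗ
        (⟨⟨fun X => X * Y, fun X X' => Matrix.add_mul X X' Y⟩, fun c X => Matrix.smul_mul c X Y⟩ :
          Matrix ι ι ℂ →ₗ[ℂ] Matrix ι ι ℂ) ∘ₗ P.π ∘ₗ D.Sinv))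

lemma moveG_apply (D : HopfData H) (A : RAct H B) (P : MRep H ι) {m : ℕ}
    (F : MultilinearMap ℂ (fun _ : Fin m => B) ℂ) (M : Fin m → Matrix ι ι B) (Y : Matrix ι ι ℂ)
    (v : Fin (m + 1) → H) : moveG D A P F M Y v =
      trM (P.π (D.Sinv (v (Fin.last m))) * Y) (actF A F fun i => v i.castSucc) M := by
  rw [trM_apply, moveG]
  simp only [sum_apply, MultilinearMap.uncurryRight_apply]
  refine Finset.sum_congr rfl fun k _ => ?_
  rw [mul_comm]
  rfl

end Move


section RH
variable {B : Type} [Ring B] [Algebra ℂ B]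
variable {ι κ : Type} [Fintype ι] [DecidableEq ι] [Fintype κ] [DecidableEq κ]

lemma sS_par_lin {U V : Type*} [AddCommGroup U] [Module ℂ U] [AddCommGroup V] [Module ℂ V]
    (D : HopfData H) (m : ℕ) (ω : H)
    (g : U → (Fin (m + 1) → H) → V) (h : ∀ v, IsLinearMap ℂ (fun u => g u v)) :
    IsLinearMap ℂ (fun u => sS D m ω (g u)) := by
  constructor
  · intro x y
    rw [← sS_add]; congr 1; funext v; exact (h v).map_add x y
  · intro c x
    rw [← sS_smul]; congr 1; funext v; exact (h v).map_smul c x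

lemma sΔ_reassoc {V : Type*} [AddCommGroup V] [Module ℂ V] (D : HopfData H) (x : H)
    (K : H → H → H → H → V)
    (h1 : ∀ b c d, IsLinearMap ℂ (fun a => K a b c d))
    (h2 : ∀ a c d, IsLinearMap ℂ (fun b => K a b c d))
    (h3 : ∀ a b d, IsLinearMap ℂ (fun c => K a b c d))
    (h4 : ∀ a b c, IsLinearMap ℂ (fun d => K a b c d)) :
    sΔ D x (fun q y => sΔ D y (fun s t => sΔ D t (fun t1 t2 => K q s t1 t2))) =
      sΔ D x (fun z t2 => sΔ D z (fun q y => sΔ D y (fun s t1 => K q s t1 t2))) := by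
  have e : ∀ q y, sΔ D y (fun s t => sΔ D t (fun t1 t2 => K q s t1 t2)) =
      sΔ D y (fun w t2 => sΔ D w (fun s t1 => K q s t1 t2)) := by
    intro q y
    exact (sΔ_coassoc D y (fun s t1 t2 => K q s t1 t2) (fun b c => h2 q b c)
      (fun a c => h3 q a c) (fun a b => h4 q a b)).symm
  simp only [e]
  exact (sΔ_coassoc D x (fun q w t2 => sΔ D w (fun s t1 => K q s t1 t2))
    (fun w t2 => sΔ_par_lin D w _ fun a b => h1 a b t2)
    (fun q t2 => sΔ_lin D _ (fun b => h2 q b t2) (fun a => h3 q a t2))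
    (fun q w => sΔ_par_lin D w _ fun a b => h4 q a b)).symm

lemma lin_trM_Yv {m : ℕ} (F : MultilinearMap ℂ (fun _ : Fin m => B) ℂ) (M : Fin m → Matrix ι ι B) :
    IsLinearMap ℂ (fun Y : Matrix ι ι ℂ => trM Y F M) :=
  ⟨fun x y => by rw [(lin_trM_Y F).map_add]; rfl, fun c x => by rw [(lin_trM_Y F).map_smul]; rfl⟩

lemma lin_trM_Fv {m : ℕ} (Y : Matrix ι ι ℂ) (M : Fin m → Matrix ι ι B) :
    IsLinearMap ℂ (fun F : MultilinearMap ℂ (fun _ : Fin m => B) ℂ => trM Y F M) :=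
  ⟨fun x y => by rw [(lin_trM_F Y).map_add]; rfl, fun c x => by rw [(lin_trM_F Y).map_smul]; rfl⟩

lemma lin_actF (A : RAct H B) {m : ℕ} (v : Fin m → H) :
    IsLinearMap ℂ (fun F : MultilinearMap ℂ (fun _ : Fin m => B) ℂ => actF A F v) :=
  ⟨fun _ _ => rfl, fun _ _ => rfl⟩

lemma inv_sΔ (D : HopfData H) (A : MAlg D B) {n : ℕ} (f : Raw H B n) (hf : IsML f)
    (hi : IsInv D A.fn f) (ω η : H) (b : Fin (n + 1) → B) :
    sΔ D ω (fun q y => sΔ D y (fun s t => sS D n t (fun v =>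
      actF A.toRAct (toF f hf (D.Sinv q * η * s)) v b))) = epsi ω * toF f hf η b := by
  have h := hi ω η b
  change sS D (n + 2) ω (fun v => f (D.Sinv (v 0) * η * v 1)
    fun i => A.act (v i.succ.succ) (b i)) = _ at h
  rw [sS_succ_first] at h
  simp only [sS_succ_first] at h
  exact h

lemma RH_core (D : HopfData H) (A : MAlg D B) (P : MRep H ι) {n : ℕ} (f : Raw H B n)
    (hf : IsML f) (hi : IsInv D A.fn f) (M : Fin (n + 1) → Matrix ι ι B)
    (hM : ∀ i, MInv D A.toRAct P P (M i)) (ω c d : H) :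
    sΔ D ω (fun p x => sΔ D x (fun q y => sΔ D y (fun s t =>
      trM (P.π (D.Sinv (D.Sinv p * d * t))) (toF f hf (D.Sinv q * c * s)) M))) =
      epsi ω * trM (P.π (D.Sinv d)) (toF f hf c) M := by
  have key : ∀ p x, sΔ D x (fun q y => sΔ D y (fun s t =>
      trM (P.π (D.Sinv (D.Sinv p * d * t))) (toF f hf (D.Sinv q * c * s)) M)) =
      trM (P.π (D.Sinv x) * (P.π (D.Sinv (D.Sinv p)) * P.π (D.Sinv d))) (toF f hf c) M := by
    intro p x
    set Y := P.π (D.Sinv (D.Sinv p)) * P.π (D.Sinv d) with hY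
    have e1 : ∀ q s t, trM (P.π (D.Sinv (D.Sinv p * d * t))) (toF f hf (D.Sinv q * c * s)) M =
        sΔ D t (fun t1 t2 => sS D n t1 (fun v => trM (P.π (D.Sinv t2) * Y)
          (actF A.toRAct (toF f hf (D.Sinv q * c * s)) v) M)) := by
      intro q s t
      have : P.π (D.Sinv (D.Sinv p * d * t)) = Y * P.π (D.Sinv t) := by
        rw [Sinv_mul, Sinv_mul, P.π_mul, P.π_mul, hY]
      rw [this, trM_move D A.toRAct P _ M hM]
      simp only [← moveG_apply]
      rw [sS_coassoc]
      simp only [moveG_apply, Fin.snoc_last, Fin.snoc_castSucc]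
    simp only [e1]
    rw [sΔ_reassoc D x (fun q s t1 t2 => sS D n t1 (fun v => trM (P.π (D.Sinv t2) * Y)
          (actF A.toRAct (toF f hf (D.Sinv q * c * s)) v) M))]
    · have e2 : ∀ z t2, (sΔ D z fun q y => sΔ D y fun s t1 => sS D n t1 fun v =>
          trM (P.π (D.Sinv t2) * Y) (actF A.toRAct (toF f hf (D.Sinv q * c * s)) v) M) =
          epsi z • trM (P.π (D.Sinv t2) * Y) (toF f hf c) M := by
        intro z t2
        simp only [trM_apply, sS_sum, sΔ_sum, Finset.smul_sum]
        refine Finset.sum_congr rfl fun k _ => ?_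
        have := inv_sΔ D A f hf hi z c (fun i => M i (k i.castSucc) (k i.succ))
        simp only [← smul_eq_mul, sS_smul, sΔ_smul] at this ⊢
        rw [this, smul_comm]
      simp only [e2]
      exact sΔ_counit_left D x (fun t2 => trM (P.π (D.Sinv t2) * Y) (toF f hf c) M)
        (lin_comp (g := fun X => trM X (toF f hf c) M) (lin_trM_Yv _ _)
          (lin_mul_right (P.π ∘ₗ D.Sinv).isLinear Y))
    · intro s t1 t2
      exact sS_par_lin D n t1 _ fun v => lin_comp (lin_trM_Fv _ _) (lin_comp (lin_actF _ _)
        (lin_comp (toF f hf).isLinear (lin_mul_right (lin_mul_right D.Sinv.isLinear c) s)))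
    · intro q t1 t2
      exact sS_par_lin D n t1 _ fun v => lin_comp (lin_trM_Fv _ _) (lin_comp (lin_actF _ _)
        (lin_comp (toF f hf).isLinear (lin_mul_left _ lin_id)))
    · intro q s t2
      have := sS_lin D n ((LinearMap.applyₗ t2).compMultilinearMap
        (moveG D A.toRAct P (toF f hf (D.Sinv q * c * s)) M Y).curryRight)
      have e5 : (⇑((LinearMap.applyₗ t2).compMultilinearMap
        (moveG D A.toRAct P (toF f hf (D.Sinv q * c * s)) M Y).curryRight) : (Fin (n + 1) → H) → ℂ)
          = fun v => trM (P.π (D.Sinv t2) * Y)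
            (actF A.toRAct (toF f hf (D.Sinv q * c * s)) v) M := by
        funext v
        change moveG D A.toRAct P (toF f hf (D.Sinv q * c * s)) M Y
          (Fin.snoc (α := fun _ => H) v t2) = _
        simp only [moveG_apply, Fin.snoc_last, Fin.snoc_castSucc]
      rw [e5] at this
      exact this
    · intro q s t1
      exact sS_par_lin D n t1 _ fun v =>
        lin_comp (g := fun X => trM X (actF A.toRAct (toF f hf (D.Sinv q * c * s)) v) M)
          (lin_trM_Yv _ _) (lin_mul_right (P.π ∘ₗ D.Sinv).isLinear Y)
  simp only [key]
  have e3 : ∀ p x, P.π (D.Sinv x) * (P.π (D.Sinv (D.Sinv p)) * P.π (D.Sinv d)) =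
      P.π (D.Sinv (x * D.Sinv p)) * P.π (D.Sinv d) := by
    intro p x
    rw [Sinv_mul, P.π_mul, mul_assoc]
  simp only [e3]
  have h := sΔ_Sinv_right D ω
  let L : H →ₗ[ℂ] ℂ := IsLinearMap.mk' (fun y => trM (P.π (D.Sinv y) * P.π (D.Sinv d))
    (toF f hf c) M) (lin_comp (g := fun X => trM X (toF f hf c) M) (lin_trM_Yv _ _)
          (lin_mul_right (P.π ∘ₗ D.Sinv).isLinear _))
  have h2 := congrArg L h
  rw [map_sΔ, map_smul] at h2
  refine h2.trans ?_
  change epsi ω * trM (P.π (D.Sinv 1) * P.π (D.Sinv d)) (toF f hf c) M = _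
  rw [Sinv_one, P.π_one, one_mul]

lemma Psi_RH (D : HopfData H) (A : MAlg D B) (P : MRep H ι) {n : ℕ} (f : Raw H B n)
    (hf : IsML f) (hi : IsInv D A.fn f) (M : Fin (n + 1) → Matrix ι ι B)
    (hM : ∀ i, MInv D A.toRAct P P (M i)) : IsRH D (fun ω => PsiRaw D P f ω M) := by
  simp only [PsiRaw_eq D P f hf]
  refine ⟨fun x y => ?_, fun c x => ?_, fun ω η => ?_⟩
  · beta_reduce; rw [(PsiM_lin D P (toF f hf)).map_add]; rfl
  · beta_reduce; rw [(PsiM_lin D P (toF f hf)).map_smul]; rfl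
  change sΔ D ω (fun x y => PsiM D P (toF f hf) (D.Sinv x * η * y) M) = _
  simp only [PsiM_apply]
  set g : H → H → ℂ := fun a b => trM (P.π (D.Sinv b)) (toF f hf a) M with hg
  have g1 : ∀ b, IsLinearMap ℂ (fun a => g a b) := fun b =>
    lin_comp (lin_trM_Fv _ _) (toF f hf).isLinear
  have g2 : ∀ a, IsLinearMap ℂ (fun b => g a b) := fun a =>
    lin_comp (g := fun X => trM X (toF f hf a) M) (lin_trM_Yv _ _) (P.π ∘ₗ D.Sinv).isLinear
  have e : ∀ x y, sΔ D (D.Sinv x * η * y) g = sΔ D η (fun c d => sΔ D x (fun p q =>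
      sΔ D y (fun s t => g (D.Sinv q * c * s) (D.Sinv p * d * t)))) := by
    intro x y
    rw [sΔ_mul D _ y g g1 g2, sΔ_mul D (D.Sinv x) η]
    · rw [sΔ_Sinv, sΔ_swap]
      · intro b
        exact sΔ_par_lin D _ _ fun c d => sΔ_par_lin D _ _ fun s t =>
          lin_comp (g1 _) (lin_mul_right (lin_mul_right lin_id _) _)
      · intro b
        exact sΔ_par_lin D _ _ fun c d => sΔ_par_lin D _ _ fun s t =>
          lin_comp (g2 _) (lin_mul_right (lin_mul_right lin_id _) _)
    · intro b
      exact sΔ_par_lin D _ _ fun s t => lin_comp (g1 _) (lin_mul_right lin_id _)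
    · intro b
      exact sΔ_par_lin D _ _ fun s t => lin_comp (g2 _) (lin_mul_right lin_id _)
  simp only [e]
  rw [sΔ_swap]
  have e4 : ∀ c d, sΔ D ω (fun x y => sΔ D x (fun p q =>
      sΔ D y (fun s t => g (D.Sinv q * c * s) (D.Sinv p * d * t)))) = epsi ω • g c d := by
    intro c d
    rw [sΔ_4 D ω (fun p q s t => g (D.Sinv q * c * s) (D.Sinv p * d * t))]
    · exact RH_core D A P f hf hi M hM ω c d
    · intro q s t
      exact lin_comp (g2 _) (lin_mul_right (lin_mul_right D.Sinv.isLinear _) _)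
    · intro q s t
      exact lin_comp (g1 _) (lin_mul_right (lin_mul_right D.Sinv.isLinear _) _)
    · intro q s t
      exact lin_comp (g1 _) (lin_mul_left _ lin_id)
    · intro q s t
      exact lin_comp (g2 _) (lin_mul_left _ lin_id)
  simp only [e4]
  rw [sΔ_smul]; rfl

end RH


section Abs
variable {E : Type} [Ring E] [Algebra ℂ E]

/-- cyclic rotation of a tuple -/
def rot {X : Type} {n : ℕ} (b : Fin (n + 1) → X) : Fin (n + 1) → X :=
  Fin.cons (α := fun _ => X) (b (Fin.last n)) fun i : Fin n => b i.castSucc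

/-- cyclicity of a multilinear functional -/
def ACyc {n : ℕ} (φ : MultilinearMap ℂ (fun _ : Fin (n + 1) => E) ℂ) : Prop :=
  ∀ b, (-1 : ℂ) ^ n * φ (rot b) = φ b

/-- Hochschild coboundary -/
def ABnd {n : ℕ} (φ : MultilinearMap ℂ (fun _ : Fin (n + 1) => E) ℂ) (b : Fin (n + 2) → E) : ℂ :=
  ∑ i : Fin (n + 1), (-1 : ℂ) ^ (i : ℕ) * φ (contract i b) +
    (-1 : ℂ) ^ (n + 1) * φ (contract 0 (rot b))

end Abs

section Transfer
variable {B : Type} [Ring B] [Algebra ℂ B]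
variable {ι κ : Type} [Fintype ι] [DecidableEq ι] [Fintype κ] [DecidableEq κ]

lemma contract_zero {n : ℕ} (b : Fin (n + 2) → B) :
    contract 0 b = Fin.cons (α := fun _ => B) (b 0 * b 1) (fun i => b i.succ.succ) := by
  funext i
  refine Fin.cases ?_ (fun i => ?_) i
  · simp [contract]
  · simp [contract]

lemma contract_zero_update {n : ℕ} (b : Fin (n + 2) → B) (j : Fin (n + 2)) :
    ∃ (i : Fin (n + 1)) (L : B →ₗ[ℂ] B), ∀ x,
      contract 0 (Function.update b j x) = Function.update (contract 0 b) i (L x) := by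
  refine Fin.cases ?_ (fun j => Fin.cases ?_ (fun j => ?_) j) j
  · refine ⟨0, LinearMap.mulRight ℂ (b 1), fun x => ?_⟩
    funext i
    refine Fin.cases ?_ (fun i => ?_) i
    · simp [contract_zero]
    · simp [contract_zero]
  · refine ⟨0, LinearMap.mulLeft ℂ (b 0), fun x => ?_⟩
    funext i
    refine Fin.cases ?_ (fun i => ?_) i
    · simp [contract_zero]
    · have : i.succ.succ ≠ (1 : Fin (n + 2)) := by simp [Fin.ext_iff]
      simp [contract_zero, Function.update_of_ne this]
  · refine ⟨j.succ, LinearMap.id, fun x => ?_⟩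
    funext i
    have h1 : (1 : Fin (n + 2)) ≠ j.succ.succ := by simp [Fin.ext_iff]
    have h0 : (0 : Fin (n + 2)) ≠ j.succ.succ := by simp [Fin.ext_iff]
    have h2 : (0 : Fin (n + 1)) ≠ j.succ := by simp [Fin.ext_iff]
    refine Fin.cases ?_ (fun i => ?_) i
    · simp [contract_zero, Function.update_of_ne h1, Function.update_of_ne h0,
        Function.update_of_ne h2]
    · by_cases h : i = j
      · subst h; simp [contract_zero]
      · have h3 : i.succ ≠ j.succ := fun e => h (Fin.succ_injective _ e)
        have h4 : i.succ.succ ≠ j.succ.succ := fun e => h3 (Fin.succ_injective _ e)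
        simp [contract_zero, Function.update_of_ne h3, Function.update_of_ne h4]

lemma IsML_contract {n : ℕ} (f : Raw H B n) (hf : IsML f) :
    IsML (fun ω (b : Fin (n + 2) → B) => f ω (contract 0 b)) := by
  refine ⟨fun ω η b => hf.1 _ _ _, fun c ω b => hf.2.1 _ _ _, fun ω b j x y => ?_,
    fun ω b j c x => ?_⟩
  · obtain ⟨i, L, h⟩ := contract_zero_update b j
    simp only [h, map_add, hf.2.2.1]
  · obtain ⟨i, L, h⟩ := contract_zero_update b j
    simp only [h, map_smul, hf.2.2.2]

lemma Psi_bRaw (D : HopfData H) (A : MAlg D B) (P : MRep H ι) {n : ℕ} (f : Raw H B n) (hf : IsML f)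
    (ω : H) (M : Fin (n + 2) → Matrix ι ι B) (hM : MInv D A.toRAct P P (M (Fin.last _))) :
    PsiRaw D P (bRaw D A.fn f) ω M = ABnd (PsiM D P (toF f hf) ω) M := by
  have e1 : PsiRaw D P (bRaw D A.fn f) ω M =
      ∑ i : Fin (n + 2), (-1 : ℂ) ^ (i : ℕ) * PsiRaw D P (dRaw D A.fn i f) ω M := by
    change sΔ D ω (fun a b => ∑ k : Fin (n + 3) → ι, P.π (D.Sinv b) (k (Fin.last (n + 2))) (k 0) *
      ∑ i : Fin (n + 2), (-1 : ℂ) ^ (i : ℕ) * dRaw D A.fn i f a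
        (fun j => M j (k j.castSucc) (k j.succ))) = ∑ i : Fin (n + 2), (-1 : ℂ) ^ (i : ℕ) *
          sΔ D ω (fun a b => ∑ k : Fin (n + 3) → ι,
            P.π (D.Sinv b) (k (Fin.last (n + 2))) (k 0) * dRaw D A.fn i f a
              (fun j => M j (k j.castSucc) (k j.succ)))
    simp only [← smul_eq_mul (a := (-1 : ℂ) ^ _), ← sΔ_smul, ← sΔ_sum]
    congr 1; funext a b
    simp only [Finset.smul_sum, Finset.mul_sum]
    rw [Finset.sum_comm]
    simp only [smul_eq_mul, mul_left_comm]
  rw [e1, Fin.sum_univ_castSucc, ABnd]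
  congr 1
  · refine Finset.sum_congr rfl fun i _ => ?_
    have : dRaw D A.fn i.castSucc f = fun ω b => f ω (contract i b) := by
      unfold dRaw
      have hi : ((i.castSucc : Fin (n + 2)) : ℕ) < n + 1 := i.is_lt
      rw [dif_pos hi]
      rfl
    rw [this, Psi_contract D P f hf, Fin.val_castSucc]
  · have : dRaw D A.fn (Fin.last (n + 1)) f = tRaw D A.fn fun ω b => f ω (contract 0 b) := by
      unfold dRaw
      rw [dif_neg (by simp)]
    rw [this, Psi_cyc D A P _ (IsML_contract f hf) ω M hM, ← PsiRaw_eq, Psi_contract D P f hf]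
    rfl

/-- restriction of `Ψ f` to the algebra of invariants -/
def phiE (D : HopfData H) (A : MAlg D B) (P : MRep H ι) {n : ℕ} (f : Raw H B n) (hf : IsML f)
    (ω : H) : MultilinearMap ℂ (fun _ : Fin (n + 1) => invAlg D A P) ℂ :=
  (PsiM D P (toF f hf) ω).compLinearMap (fun _ => (invAlg D A P).val.toLinearMap)

lemma phiE_apply (D : HopfData H) (A : MAlg D B) (P : MRep H ι) {n : ℕ} (f : Raw H B n)
    (hf : IsML f) (ω : H) (b : Fin (n + 1) → invAlg D A P) :
    phiE D A P f hf ω b = PsiRaw D P f ω (fun i => (b i : Matrix ι ι B)) := by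
  rw [PsiRaw_eq D P f hf]; rfl

lemma coe_rot {n : ℕ} (S : Subalgebra ℂ (Matrix ι ι B)) (b : Fin (n + 1) → S) :
    (fun i => ((rot b i : S) : Matrix ι ι B)) = rot (fun i => (b i : Matrix ι ι B)) := by
  funext i
  refine Fin.cases ?_ (fun i => ?_) i <;> simp [rot]

lemma coe_contract {n : ℕ} (S : Subalgebra ℂ (Matrix ι ι B)) (b : Fin (n + 2) → S)
    (i : Fin (n + 1)) :
    (fun j => ((contract i b j : S) : Matrix ι ι B)) = contract i (fun j => (b j : Matrix ι ι B)) := by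
  funext j
  unfold contract
  split_ifs <;> simp

lemma phiE_cyc (D : HopfData H) (A : MAlg D B) (P : MRep H ι) {n : ℕ} (f : Raw H B n)
    (hf : IsML f) (hc : IsCyc D A.fn f) (ω : H) : ACyc (phiE D A P f hf ω) := by
  intro b
  rw [phiE_apply, phiE_apply, coe_rot, PsiRaw_eq D P f hf]
  have h := Psi_cyc D A P f hf ω (fun i => (b i : Matrix ι ι B)) (b (Fin.last n)).2
  have h2 : f = fun ω b => (-1 : ℂ) ^ n * tRaw D A.fn f ω b := by
    funext ω b; exact (hc ω b).symm
  have h3 : PsiRaw D P f ω (fun i => (b i : Matrix ι ι B)) =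
      (-1 : ℂ) ^ n * PsiRaw D P (tRaw D A.fn f) ω (fun i => (b i : Matrix ι ι B)) := by
    conv_lhs => rw [h2]
    change sΔ D ω (fun a c => ∑ k : Fin (n + 2) → ι, P.π (D.Sinv c) (k (Fin.last (n + 1))) (k 0) *
      ((-1 : ℂ) ^ n * tRaw D A.fn f a (fun i => (b i : Matrix ι ι B) (k i.castSucc) (k i.succ)))) =
      (-1 : ℂ) ^ n • sΔ D ω (fun a c => ∑ k : Fin (n + 2) → ι,
        P.π (D.Sinv c) (k (Fin.last (n + 1))) (k 0) *
        (tRaw D A.fn f a (fun i => (b i : Matrix ι ι B) (k i.castSucc) (k i.succ))))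
    rw [← sΔ_smul]
    congr 1; funext a c
    rw [Finset.smul_sum]
    refine Finset.sum_congr rfl fun k _ => ?_
    rw [smul_eq_mul, mul_left_comm]
  rw [h3, h]
  rfl

lemma phiE_bnd (D : HopfData H) (A : MAlg D B) (P : MRep H ι) {n : ℕ} (f : Raw H B n)
    (hf : IsML f) (ω : H) (b : Fin (n + 2) → invAlg D A P) :
    PsiRaw D P (bRaw D A.fn f) ω (fun i => (b i : Matrix ι ι B)) = ABnd (phiE D A P f hf ω) b := by
  rw [Psi_bRaw D A P f hf ω (fun i => (b i : Matrix ι ι B)) (b (Fin.last _)).2]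
  unfold ABnd
  simp only [phiE_apply, PsiRaw_eq D P f hf, coe_contract, coe_rot]

lemma phiE_coc (D : HopfData H) (A : MAlg D B) (P : MRep H ι) {n : ℕ} (f : Raw H B n)
    (hf : IsML f) (hb : ∀ ω b, bRaw D A.fn f ω b = 0) (ω : H) (b : Fin (n + 2) → invAlg D A P) :
    ABnd (phiE D A P f hf ω) b = 0 := by
  rw [← phiE_bnd]
  have : bRaw D A.fn f = fun _ _ => 0 := by funext ω b; exact hb ω b
  rw [this]
  simp [PsiRaw]

end Transfer


section AbsEven
variable {E : Type} [Ring E] [Algebra ℂ E]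

lemma mm_deriv {m : ℕ} (φ : MultilinearMap ℂ (fun _ : Fin m => E) ℂ) (c d : Fin m → E) (t : ℂ) :
    HasDerivAt (fun s : ℂ => φ (fun i => c i + s • d i))
      (∑ i, φ (Function.update (fun j => c j + t • d j) i (d i))) t := by
  induction m with
  | zero =>
    simp only [Finset.univ_eq_empty, Finset.sum_empty]
    have : (fun s : ℂ => φ (fun i => c i + s • d i)) = fun _ => φ c := by
      funext s; congr 1; funext i; exact i.elim0
    rw [this]; exact hasDerivAt_const _ _
  | succ m ih =>
    have key : ∀ s : ℂ, φ (fun i => c i + s • d i) =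
        φ.curryLeft (c 0) (fun i => c i.succ + s • d i.succ) +
          s * φ.curryLeft (d 0) (fun i => c i.succ + s • d i.succ) := by
      intro s
      have h1 : (fun i => c i + s • d i) =
          Fin.cons (α := fun _ => E) (c 0 + s • d 0) (fun i => c i.succ + s • d i.succ) := by
        funext i; refine Fin.cases ?_ (fun i => ?_) i <;> simp
      have h2 := congrArg φ h1
      rw [h2]
      change φ.curryLeft (c 0 + s • d 0) _ = _
      rw [map_add, map_smul]; rfl
    have hA := ih (φ.curryLeft (c 0)) (fun i => c i.succ) (fun i => d i.succ)
    have hB := ih (φ.curryLeft (d 0)) (fun i => c i.succ) (fun i => d i.succ)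
    have := hA.add ((hasDerivAt_id t).mul hB)
    refine (this.congr_of_eventuallyEq (Filter.Eventually.of_forall key)).congr_deriv ?_
    rw [Fin.sum_univ_succ]
    have e0 : Function.update (fun j => c j + t • d j) 0 (d 0) =
        Fin.cons (α := fun _ => E) (d 0) (fun i => c i.succ + t • d i.succ) := by
      funext i; refine Fin.cases ?_ (fun i => ?_) i <;> simp
    have e1 : ∀ i : Fin m, Function.update (fun j => c j + t • d j) i.succ (d i.succ) =
        Fin.cons (α := fun _ => E) (c 0 + t • d 0)
          (Function.update (fun i => c i.succ + t • d i.succ) i (d i.succ)) := by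
      intro i
      funext j; refine Fin.cases ?_ (fun j => ?_) j
      · simp [Function.update_of_ne (Fin.succ_ne_zero i).symm]
      · by_cases h : j = i
        · subst h; simp
        · have h3 : j.succ ≠ i.succ := fun e => h (Fin.succ_injective _ e)
          simp [Function.update_of_ne h3, Function.update_of_ne h]
    have e2 : ∀ i : Fin m, φ (Function.update (fun j => c j + t • d j) i.succ (d i.succ)) =
        φ.curryLeft (c 0) (Function.update (fun i => c i.succ + t • d i.succ) i (d i.succ)) +
        t * φ.curryLeft (d 0)
          (Function.update (fun i => c i.succ + t • d i.succ) i (d i.succ)) := by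
      intro i
      rw [e1 i]
      change φ.curryLeft (c 0 + t • d 0) _ = _
      rw [map_add, map_smul]; rfl
    rw [e0]
    simp only [e2, Finset.sum_add_distrib, ← Finset.mul_sum]
    change _ = φ.curryLeft (d 0) _ + _
    simp only [id, one_mul]
    ring

lemma mm_const {m : ℕ} (φ : MultilinearMap ℂ (fun _ : Fin m => E) ℂ) (c d : Fin m → E)
    (h : ∀ t : ℂ, ∑ i, φ (Function.update (fun j => c j + t • d j) i (d i)) = 0) :
    φ c = φ (fun i => c i + d i) := by
  have h1 := is_const_of_deriv_eq_zero (f := fun s : ℂ => φ (fun i => c i + s • d i))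
    (fun t => (mm_deriv φ c d t).differentiableAt)
    (fun t => by rw [(mm_deriv φ c d t).deriv, h t]) 0 1
  simpa using h1

lemma rot_const {X : Type} {n : ℕ} (p : X) : rot (fun _ : Fin (n + 1) => p) = fun _ => p := by
  funext i; refine Fin.cases ?_ (fun i => ?_) i <;> simp [rot]

lemma contract_const {n : ℕ} (p : E) (hp : p * p = p) (i : Fin (n + 1)) :
    contract i (fun _ : Fin (n + 2) => p) = fun _ => p := by
  funext j; simp [contract, hp]

lemma even_bnd {n : ℕ} (φ : MultilinearMap ℂ (fun _ : Fin (2 * n + 1 + 1) => E) ℂ) (hφ : ACyc φ)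
    (p : E) (hp : p * p = p) : ABnd φ (fun _ => p) = 0 := by
  have h0 : φ (fun _ => p) = 0 := by
    have := hφ (fun _ => p)
    rw [rot_const, pow_succ, pow_mul] at this
    have h2 : (2 : ℂ) * φ (fun _ => p) = 0 := by
      simp at this; linear_combination -this
    simpa using h2
  unfold ABnd
  rw [rot_const]
  simp [contract_const p hp, h0]

lemma rot_update {X : Type} {n : ℕ} (p x : X) (i : Fin n) :
    rot (Function.update (fun _ : Fin (n + 1) => p) i.castSucc x) =
      Function.update (fun _ => p) i.succ x := by
  funext j; refine Fin.cases ?_ (fun j => ?_) j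
  · have h1 : Fin.last n ≠ i.castSucc := (Fin.castSucc_lt_last i).ne'
    simp [rot, Function.update_of_ne h1, Function.update_of_ne (Fin.succ_ne_zero i).symm]
  · by_cases h : j = i
    · subst h; simp [rot]
    · have h3 : j.succ ≠ i.succ := fun e => h (Fin.succ_injective _ e)
      have h4 : j.castSucc ≠ i.castSucc := fun e => h (Fin.castSucc_injective _ e)
      simp [rot, Function.update_of_ne h3, Function.update_of_ne h4]

lemma even_update {n : ℕ} (φ : MultilinearMap ℂ (fun _ : Fin (2 * n + 1) => E) ℂ) (hφ : ACyc φ)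
    (p x : E) (i : Fin (2 * n + 1)) :
    φ (Function.update (fun _ => p) i x) = φ (Function.update (fun _ => p) 0 x) := by
  induction i using Fin.induction with
  | zero => rfl
  | succ i ih =>
    rw [← ih, ← hφ (Function.update (fun _ => p) i.castSucc x), rot_update]
    simp [pow_mul]

lemma sum_alt_even (n : ℕ) : ∑ i : Fin (2 * n), (-1 : ℂ) ^ (i : ℕ) = 0 := by
  rw [Fin.sum_univ_eq_sum_range (fun i => (-1 : ℂ) ^ i) (2 * n)]
  induction n with
  | zero => simp
  | succ n ih => rw [Nat.mul_succ, Finset.sum_range_succ, Finset.sum_range_succ, ih]; simp [pow_add]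

lemma even_comm {n : ℕ} (φ : MultilinearMap ℂ (fun _ : Fin (2 * n + 1) => E) ℂ)
    (hb : ∀ b, ABnd φ b = 0) (p N : E) (hp : p * p = p) :
    φ (Function.update (fun _ => p) 0 (N * p - p * N)) = 0 := by
  have h := hb (Fin.cons (α := fun _ => E) N (fun _ => p))
  unfold ABnd at h
  have e0 : ∀ x : E, Function.update (fun _ : Fin (2 * n + 1) => p) 0 x =
      Fin.cons (α := fun _ => E) x (fun _ => p) := by
    intro x; funext i; refine Fin.cases ?_ (fun i => ?_) i <;> simp
  have e1 : contract (0 : Fin (2 * n + 1)) (Fin.cons (α := fun _ => E) N (fun _ => p)) =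
      Fin.cons (α := fun _ => E) (N * p) (fun _ => p) := by
    rw [contract_zero]
    congr 1
  have e2 : ∀ i : Fin (2 * n), contract i.succ (Fin.cons (α := fun _ => E) N (fun _ => p)) =
      Fin.cons (α := fun _ => E) N (fun _ => p) := by
    intro i; funext j
    refine Fin.cases ?_ (fun j => ?_) j
    · simp [contract]
    · simp [contract, hp, ← Fin.succ_castSucc]
  have e3 : contract (0 : Fin (2 * n + 1)) (rot (Fin.cons (α := fun _ => E) N (fun _ => p))) =
      Fin.cons (α := fun _ => E) (p * N) (fun _ => p) := by
    rw [contract_zero]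
    congr 1
  rw [Fin.sum_univ_succ, e1, e3] at h
  simp only [e2, Fin.val_succ, pow_succ, ← Finset.sum_mul, sum_alt_even] at h
  rw [sub_eq_add_neg, φ.map_update_add, φ.map_update_neg, e0, e0]
  simp [pow_mul] at h
  linear_combination h

lemma even_path {n : ℕ} (φ : MultilinearMap ℂ (fun _ : Fin (2 * n + 1) => E) ℂ) (hφ : ACyc φ)
    (hb : ∀ b, ABnd φ b = 0) (e f : E) (he : e * e = e) (hf : f * f = f)
    (h : (e * f = e ∧ f * e = f) ∨ (e * f = f ∧ f * e = e)) :
    φ (fun _ => e) = φ (fun _ => f) := by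
  have := mm_const φ (fun _ => e) (fun _ => f - e) ?_
  · rw [this]; simp
  intro t
  have hid : (e + t • (f - e)) * (e + t • (f - e)) = e + t • (f - e) := by
    rcases h with ⟨h1, h2⟩ | ⟨h1, h2⟩ <;>
    · simp only [mul_add, add_mul, mul_sub, sub_mul, smul_mul_assoc, mul_smul_comm, he, hf, h1, h2]
      module
  refine Finset.sum_eq_zero fun i _ => ?_
  rw [even_update φ hφ]
  rcases h with ⟨h1, h2⟩ | ⟨h1, h2⟩
  · have := even_comm φ hb (e + t • (f - e)) (f - e) hid
    rw [← this]; congr 2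
    simp only [mul_add, add_mul, mul_sub, sub_mul, smul_mul_assoc, mul_smul_comm, he, hf, h1, h2]
    module
  · have := even_comm φ hb (e + t • (f - e)) (-(f - e)) hid
    rw [← this]; congr 2
    simp only [neg_mul, mul_neg, mul_add, add_mul, mul_sub, sub_mul, smul_mul_assoc, mul_smul_comm, he, hf, h1, h2]
    module

end AbsEven


section AbsOdd
variable {E : Type} [Ring E] [Algebra ℂ E]

lemma tele_sum {k : ℕ} (R : Fin (k + 2) → ℂ) :
    ∑ j : Fin (k + 1), (-1 : ℂ) ^ (j : ℕ) * (R j.succ + R j.castSucc) =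
      R 0 + (-1 : ℂ) ^ k * R (Fin.last _) := by
  induction k with
  | zero => simp; ring
  | succ k ih =>
    rw [Fin.sum_univ_castSucc]
    have := ih (fun j => R j.castSucc)
    simp only [Fin.val_castSucc, Fin.succ_castSucc, Fin.castSucc_zero] at this ⊢
    rw [this]
    simp only [Fin.val_last, Fin.succ_last]
    ring

lemma contract_tele {k : ℕ} (φ : MultilinearMap ℂ (fun _ : Fin (k + 1) => E) ℂ)
    (c : Fin (k + 2) → E) (j : Fin (k + 1))
    (hc : c j.castSucc * c j.succ = -(c j.castSucc + c j.succ)) :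
    φ (contract j c) = -(φ (fun i => c (j.succ.succAbove i)) +
      φ (fun i => c (j.castSucc.succAbove i))) := by
  have key : ∀ i : Fin (k + 1), i ≠ j → contract j c i = c (j.succ.succAbove i) ∧
      contract j c i = c (j.castSucc.succAbove i) := by
    intro i hi
    rcases lt_or_gt_of_ne hi with h | h <;> have hv := Fin.lt_def.1 h
    · rw [Fin.succAbove_of_castSucc_lt _ _ (by rw [Fin.lt_def]; simp only [Fin.val_castSucc, Fin.val_succ]; omega),
        Fin.succAbove_of_castSucc_lt _ _ (by rw [Fin.lt_def]; exact hv)]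
      simp only [contract, if_pos hv, and_self]
    · rw [Fin.succAbove_of_le_castSucc _ _ (by rw [Fin.le_def]; simp only [Fin.val_castSucc, Fin.val_succ]; omega),
        Fin.succAbove_of_le_castSucc _ _ (by rw [Fin.le_def]; simp only [Fin.val_castSucc, Fin.val_succ]; omega)]
      have h1 : ¬ ((i : ℕ) < j) := by omega
      have h2 : ¬ ((i : ℕ) = j) := by omega
      simp only [contract, if_neg h1, if_neg h2, and_self]
  have e0 : contract j c = Function.update (contract j c) j (-(c j.castSucc + c j.succ)) := by
    rw [← hc, eq_comm, Function.update_eq_self_iff]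
    simp [contract]
  have e1 : (fun i => c (j.succ.succAbove i)) =
      Function.update (contract j c) j (c j.castSucc) := by
    funext i
    by_cases h : i = j
    · subst h
      rw [Function.update_self, Fin.succAbove_of_castSucc_lt _ _ (by simp [Fin.lt_def])]
    · rw [Function.update_of_ne h, (key i h).1]
  have e2 : (fun i => c (j.castSucc.succAbove i)) =
      Function.update (contract j c) j (c j.succ) := by
    funext i
    by_cases h : i = j
    · subst h
      rw [Function.update_self, Fin.succAbove_of_le_castSucc _ _ le_rfl]
    · rw [Function.update_of_ne h, (key i h).2]
  have e0' := congrArg φ e0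
  rw [e0', e1, e2, φ.map_update_neg, φ.map_update_add]

lemma tele {k : ℕ} (φ : MultilinearMap ℂ (fun _ : Fin (k + 1) => E) ℂ)
    (c : Fin (k + 2) → E)
    (hc : ∀ j : Fin (k + 1), c j.castSucc * c j.succ = -(c j.castSucc + c j.succ)) :
    ∑ j : Fin (k + 1), (-1 : ℂ) ^ (j : ℕ) * φ (contract j c) =
      -(φ (fun i => c i.succ) + (-1 : ℂ) ^ k * φ (fun i => c i.castSucc)) := by
  have h := tele_sum (fun j : Fin (k + 2) => φ (fun i => c (j.succAbove i)))
  simp only [Fin.succAbove_zero, Fin.succAbove_last] at h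
  rw [← h, ← Finset.sum_neg_distrib]
  refine Finset.sum_congr rfl fun j _ => ?_
  rw [contract_tele φ c j (hc j)]
  ring

lemma altT_hc {m : ℕ} (u u' : E) (h1 : u * u' = 1) (h2 : u' * u = 1) (j : Fin (m + 1)) :
    altT (m + 2) u u' j.castSucc * altT (m + 2) u u' j.succ =
      -(altT (m + 2) u u' j.castSucc + altT (m + 2) u u' j.succ) := by
  simp only [altT, Fin.val_castSucc, Fin.val_succ]
  by_cases h : (j : ℕ) % 2 = 0
  · have h' : ¬ (((j : ℕ) + 1) % 2 = 0) := by omega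
    rw [if_pos h, if_neg h', sub_mul, mul_sub, h2]
    simp only [mul_one, one_mul]
    abel
  · have h' : (((j : ℕ) + 1) % 2 = 0) := by omega
    rw [if_neg h, if_pos h', sub_mul, mul_sub, h1]
    simp only [mul_one, one_mul]
    abel

lemma altT_succ {m : ℕ} (u u' : E) (i : Fin m) : altT (m + 1) u u' i.succ = altT m u' u i := by
  simp only [altT, Fin.val_succ]
  by_cases h : (i : ℕ) % 2 = 0
  · have h' : ¬ (((i : ℕ) + 1) % 2 = 0) := by omega
    rw [if_pos h, if_neg h']
  · have h' : (((i : ℕ) + 1) % 2 = 0) := by omega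
    rw [if_neg h, if_pos h']

lemma altT_castSucc {m : ℕ} (u u' : E) (i : Fin m) :
    altT (m + 1) u u' i.castSucc = altT m u u' i := rfl

lemma altT_zero {m : ℕ} (u u' : E) : altT (m + 1) u u' 0 = u' - 1 := by simp [altT]

lemma altT_last {n : ℕ} (u u' : E) : altT (2 * n + 2) u u' (Fin.last _) = u - 1 := by
  have : ¬ ((2 * n + 1) % 2 = 0) := by omega
  simp [altT, this]

lemma rot_altT {n : ℕ} (u u' : E) : rot (altT (2 * n + 2) u u') = altT (2 * n + 2) u' u := by
  funext i
  refine Fin.cases ?_ (fun i => ?_) i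
  · simp only [rot, Fin.cons_zero]; rw [altT_last, altT_zero]
  · simp only [rot, Fin.cons_succ]; rw [altT_succ, altT_castSucc]

lemma odd_bnd {n : ℕ} (φ : MultilinearMap ℂ (fun _ : Fin (2 * n + 1) => E) ℂ) (hφ : ACyc φ)
    (u u' : E) (h1 : u * u' = 1) (h2 : u' * u = 1) : ABnd φ (altT (2 * n + 2) u u') = 0 := by
  unfold ABnd
  rw [tele φ _ (altT_hc u u' h1 h2), rot_altT, contract_tele φ _ 0 (altT_hc u' u h2 h1 0)]
  simp only [Fin.castSucc_zero, Fin.succAbove_zero, altT_succ, altT_castSucc]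
  have h := hφ (altT (2 * n + 1) u' u)
  have e : (fun i => altT (2 * n + 2) u' u ((0 : Fin (2 * n + 1)).succ.succAbove i)) =
      rot (altT (2 * n + 1) u' u) := by
    funext i
    refine Fin.cases ?_ (fun i => ?_) i
    · rw [Fin.succAbove_of_castSucc_lt _ _ (by simp [Fin.lt_def])]
      simp [rot, altT]
    · rw [Fin.succAbove_of_le_castSucc _ _ (by simp [Fin.le_def])]
      simp only [rot, Fin.cons_succ, altT, Fin.val_succ, Fin.val_castSucc]
      have : ((i : ℕ) + 1 + 1) % 2 = (i : ℕ) % 2 := by omega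
      simp only [this]
  rw [e]
  simp [pow_mul, pow_succ] at h ⊢
  rw [h]
  ring

lemma odd_L3 {n : ℕ} (φ : MultilinearMap ℂ (fun _ : Fin (2 * n + 1 + 1) => E) ℂ)
    (hb : ∀ b, ABnd φ b = 0) (u u' a : E) (h1 : u * u' = 1) (h2 : u' * u = 1) :
    φ (Fin.cons (α := fun _ => E) (a * u') (altT (2 * n + 1) u' u)) +
      φ (Fin.cons (α := fun _ => E) (u * a) (altT (2 * n + 1) u u')) = 0 := by
  have h := hb (Fin.cons (α := fun _ => E) a (altT (2 * n + 2) u u'))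
  unfold ABnd at h
  have e1 : contract (0 : Fin (2 * n + 1 + 1))
      (Fin.cons (α := fun _ => E) a (altT (2 * n + 2) u u')) =
      Fin.cons (α := fun _ => E) (a * (u' - 1)) (altT (2 * n + 1) u' u) := by
    rw [contract_zero]
    congr 1
    funext i
    rw [Fin.cons_succ, altT_succ]
  have e2 : ∀ i : Fin (2 * n + 1), contract i.succ
      (Fin.cons (α := fun _ => E) a (altT (2 * n + 2) u u')) =
      Fin.cons (α := fun _ => E) a (contract i (altT (2 * n + 2) u u')) := by
    intro i; funext j
    refine Fin.cases ?_ (fun j => ?_) j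
    · simp [contract]
    · simp [contract, ← Fin.succ_castSucc]
  have e3 : contract (0 : Fin (2 * n + 1 + 1))
      (rot (Fin.cons (α := fun _ => E) a (altT (2 * n + 2) u u'))) =
      Fin.cons (α := fun _ => E) ((u - 1) * a) (altT (2 * n + 1) u u') := by
    rw [contract_zero]
    congr 1
    rw [← altT_last (n := n) u u']
    rfl
  rw [Fin.sum_univ_succ, e1, e3] at h
  have e4 := tele (φ.curryLeft a) (altT (2 * n + 2) u u') (altT_hc u u' h1 h2)
  simp only [altT_succ, altT_castSucc, pow_mul, neg_one_sq, one_pow, one_mul] at e4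
  have e5 : ∑ i : Fin (2 * n + 1), (-1 : ℂ) ^ (i.succ : ℕ) * φ (contract i.succ
      (Fin.cons (α := fun _ => E) a (altT (2 * n + 2) u u'))) =
      - ∑ i : Fin (2 * n + 1), (-1 : ℂ) ^ (i : ℕ) *
        (φ.curryLeft a) (contract i (altT (2 * n + 2) u u')) := by
    rw [← Finset.sum_neg_distrib]
    refine Finset.sum_congr rfl fun i _ => ?_
    rw [e2, Fin.val_succ, pow_succ]
    change _ = -(_ * φ (Fin.cons (α := fun _ => E) a (contract i (altT (2 * n + 2) u u'))))
    ring
  rw [e5, e4] at h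
  have l : ∀ (x : E) (c : Fin (2 * n + 1) → E), φ (Fin.cons (α := fun _ => E) x c) =
    φ.curryLeft x c := fun _ _ => rfl
  simp only [l, mul_sub, sub_mul, mul_one, one_mul, map_sub, sub_apply] at h ⊢
  have e6 : (-1 : ℂ) ^ (2 * n + 1 + 1) = 1 := by simp [pow_succ, pow_mul]
  rw [e6] at h
  simp only [Fin.val_zero, pow_zero, one_mul] at h
  change _ + - -(φ.curryLeft a (altT (2 * n + 1) u' u) + φ.curryLeft a (altT (2 * n + 1) u u')) + _ = 0 at h
  linear_combination h

lemma odd_rot_update {n : ℕ} (u u' x : E) (i : Fin (2 * n + 1)) :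
    rot (Function.update (altT (2 * n + 2) u u') i.castSucc x) =
      Function.update (altT (2 * n + 2) u' u) i.succ x := by
  funext j; refine Fin.cases ?_ (fun j => ?_) j
  · have h1 : Fin.last _ ≠ i.castSucc := (Fin.castSucc_lt_last i).ne'
    simp only [rot, Fin.cons_zero, Function.update_of_ne h1,
      Function.update_of_ne (Fin.succ_ne_zero i).symm]
    rw [altT_last, altT_zero]
  · by_cases h : j = i
    · subst h; simp [rot]
    · have h3 : j.succ ≠ i.succ := fun e => h (Fin.succ_injective _ e)
      have h4 : j.castSucc ≠ i.castSucc := fun e => h (Fin.castSucc_injective _ e)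
      simp only [rot, Fin.cons_succ, Function.update_of_ne h3, Function.update_of_ne h4]
      rw [altT_succ, altT_castSucc]

lemma odd_S {n : ℕ} (φ : MultilinearMap ℂ (fun _ : Fin (2 * n + 1 + 1) => E) ℂ) (hφ : ACyc φ)
    (x : E) (i : Fin (2 * n + 1 + 1)) : ∀ u u' : E,
    φ (Function.update (altT (2 * n + 2) u u') i x) =
      if (i : ℕ) % 2 = 0 then φ (Function.update (altT (2 * n + 2) u u') 0 x)
      else - φ (Function.update (altT (2 * n + 2) u' u) 0 x) := by
  induction i using Fin.induction with
  | zero => intro u u'; simp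
  | succ i ih =>
    intro u u'
    have h := hφ (Function.update (altT (2 * n + 2) u' u) i.castSucc x)
    rw [odd_rot_update, ih u' u] at h
    simp only [Fin.val_succ, Fin.val_castSucc] at h ⊢
    have e6 : (-1 : ℂ) ^ (2 * n + 1) = -1 := by simp [pow_succ, pow_mul]
    rw [e6] at h
    by_cases h0 : (i : ℕ) % 2 = 0
    · have h' : ¬ (((i : ℕ) + 1) % 2 = 0) := by omega
      rw [if_neg h']; rw [if_pos h0] at h
      linear_combination -h
    · have h' : (((i : ℕ) + 1) % 2 = 0) := by omega
      rw [if_pos h']; rw [if_neg h0] at h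
      linear_combination -h

lemma odd_unip {n : ℕ} (φ : MultilinearMap ℂ (fun _ : Fin (2 * n + 1 + 1) => E) ℂ) (hφ : ACyc φ)
    (hb : ∀ b, ABnd φ b = 0) (u u' N : E) (h1 : u * u' = 1) (h2 : u' * u = 1) (hN : N * N = 0) :
    φ (altT (2 * n + 2) u u') = φ (altT (2 * n + 2) (u * (1 + N)) ((1 - N) * u')) := by
  have := mm_const φ (altT (2 * n + 2) u u')
    (fun i => if (i : ℕ) % 2 = 0 then -(N * u') else u * N) ?_
  · rw [this]
    congr 1; funext i
    simp only [altT]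
    split_ifs
    · rw [sub_mul, one_mul]; abel
    · rw [mul_add, mul_one]; abel
  intro t
  have e : (fun j : Fin (2 * n + 1 + 1) => altT (2 * n + 2) u u' j +
      t • (if (j : ℕ) % 2 = 0 then -(N * u') else u * N)) =
      altT (2 * n + 2) (u + t • (u * N)) (u' - t • (N * u')) := by
    funext i
    simp only [altT]
    split_ifs
    · rw [smul_neg]; abel
    · abel
  rw [e]
  have hN1 : ∀ x y : E, x * N * (N * y) = 0 := fun x y => by
    rw [mul_assoc, ← mul_assoc N, hN]; simp
  have hN2 : u * N * N = 0 := by rw [mul_assoc, hN, mul_zero]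
  have hN3 : N * (N * u') = 0 := by rw [← mul_assoc, hN, zero_mul]
  have g1 : (u + t • (u * N)) * (u' - t • (N * u')) = 1 := by
    simp only [add_mul, mul_sub, smul_mul_assoc, mul_smul_comm, hN1, h1, mul_assoc]
    simp
  have g2 : (u' - t • (N * u')) * (u + t • (u * N)) = 1 := by
    have a1 : u' * (u * N) = N := by rw [← mul_assoc, h2, one_mul]
    have a2 : N * u' * u = N := by rw [mul_assoc, h2, mul_one]
    have a3 : N * u' * (u * N) = 0 := by rw [← mul_assoc, a2, hN]
    simp only [mul_add, sub_mul, smul_mul_assoc, mul_smul_comm, h2, a1, a2, a3]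
    simp
  have hL := odd_L3 φ hb _ _ N g1 g2
  have b1 : N * (u' - t • (N * u')) = N * u' := by
    rw [mul_sub, mul_smul_comm, hN3]; simp
  have b2 : (u + t • (u * N)) * N = u * N := by
    rw [add_mul, smul_mul_assoc, hN2]; simp
  rw [b1, b2] at hL
  set U := u + t • (u * N)
  set U' := u' - t • (N * u')
  have e0 : ∀ (x w w' : E), Function.update (altT (2 * n + 2) w w') 0 x =
      Fin.cons (α := fun _ => E) x (altT (2 * n + 1) w' w) := by
    intro x w w'; funext i; refine Fin.cases ?_ (fun i => ?_) i
    · simp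
    · rw [Function.update_of_ne (Fin.succ_ne_zero i), Fin.cons_succ, altT_succ]
  rw [← e0, ← e0] at hL
  have hT : ∀ i : Fin (2 * n + 1 + 1), φ (Function.update (altT (2 * n + 2) U U') i
      (if (i : ℕ) % 2 = 0 then -(N * u') else u * N)) =
      (-1 : ℂ) ^ (i : ℕ) * -φ (Function.update (altT (2 * n + 2) U U') 0 (N * u')) := by
    intro i
    rw [odd_S φ hφ]
    by_cases h0 : (i : ℕ) % 2 = 0
    · rw [if_pos h0, if_pos h0, (Nat.even_iff.2 h0).neg_one_pow, φ.map_update_neg]; ring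
    · rw [if_neg h0, if_neg h0, (Nat.odd_iff.2 (by omega)).neg_one_pow]
      linear_combination -hL
  simp only [hT, ← Finset.sum_mul]
  have := sum_alt_even (n + 1)
  rw [show ∑ i : Fin (2 * n + 1 + 1), (-1 : ℂ) ^ (i : ℕ) = 0 from this, zero_mul]

end AbsOdd


section Concrete
variable {B : Type} [Ring B] [Algebra ℂ B]
variable {ι κ : Type} [Fintype ι] [DecidableEq ι] [Fintype κ] [DecidableEq κ]

lemma Psi_path (D : HopfData H) (A : MAlg D B) (P : MRep H ι) {n : ℕ} (f : Raw H B (2 * n))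
    (hf : IsCocycle D A.fn f) (ω : H) (e g : Matrix ι ι B) (hei : MInv D A.toRAct P P e)
    (hgi : MInv D A.toRAct P P g) (he : e * e = e) (hg : g * g = g)
    (h : (e * g = e ∧ g * e = g) ∨ (e * g = g ∧ g * e = e)) :
    PsiRaw D P f ω (fun _ => e) = PsiRaw D P f ω (fun _ => g) := by
  obtain ⟨⟨hml, -⟩, hc, hb⟩ := hf
  have := even_path (phiE D A P f hml ω) (phiE_cyc D A P f hml hc ω) (phiE_coc D A P f hml hb ω)
    ⟨e, hei⟩ ⟨g, hgi⟩ (Subtype.ext he) (Subtype.ext hg) (by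
      rcases h with ⟨h1, h2⟩ | ⟨h1, h2⟩
      · exact Or.inl ⟨Subtype.ext h1, Subtype.ext h2⟩
      · exact Or.inr ⟨Subtype.ext h1, Subtype.ext h2⟩)
  rwa [phiE_apply, phiE_apply] at this

lemma coe_altT (S : Subalgebra ℂ (Matrix ι ι B)) (m : ℕ) (u u' : S) :
    (fun i => ((altT m u u' i : S) : Matrix ι ι B)) = altT m (u : Matrix ι ι B) u' := by
  funext i
  unfold altT
  split_ifs <;> simp

/-- bookkeeping predicate: `u` is an invariant invertible with pairing `c` -/
def OddVal (D : HopfData H) (A : MAlg D B) (P : MRep H ι) {n : ℕ} (f : Raw H B (2 * n + 1))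
    (ω : H) (c : ℂ) (u : Matrix ι ι B) : Prop :=
  ∃ u', u * u' = 1 ∧ u' * u = 1 ∧ MInv D A.toRAct P P u ∧
    PsiRaw D P f ω (altT (2 * n + 2) u u') = c

lemma OddVal_step (D : HopfData H) (A : MAlg D B) (P : MRep H ι) {n : ℕ} (f : Raw H B (2 * n + 1))
    (hf : IsCocycle D A.fn f) (ω : H) (c : ℂ) (u N : Matrix ι ι B)
    (hu : OddVal D A P f ω c u) (hNi : MInv D A.toRAct P P N) (hN : N * N = 0) :
    OddVal D A P f ω c (u * (1 + N)) := by
  obtain ⟨u', h1, h2, hi, hv⟩ := hu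
  have a1 : (1 + N) * (1 - N) = 1 := by
    rw [add_mul, mul_sub, mul_sub, hN]; simp
  have a2 : (1 - N) * (1 + N) = 1 := by
    rw [sub_mul, mul_add, mul_add, hN]; simp
  refine ⟨(1 - N) * u', ?_, ?_, ?_, ?_⟩
  · rw [mul_assoc, ← mul_assoc (1 + N), a1, one_mul, h1]
  · rw [mul_assoc, ← mul_assoc u', h2, one_mul, a2]
  · exact MInv_mul D A P P P _ _ hi (MInv_add D _ P P _ _ (MInv_one D A P) hNi)
  · obtain ⟨⟨hml, -⟩, hc, hb⟩ := hf
    have := odd_unip (phiE D A P f hml ω) (phiE_cyc D A P f hml hc ω) (phiE_coc D A P f hml hb ω)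
      ⟨u, hi⟩ ⟨u', MInv_inv D A P u u' h1 h2 hi⟩ ⟨N, hNi⟩ (Subtype.ext h1) (Subtype.ext h2)
      (Subtype.ext hN)
    rw [phiE_apply, phiE_apply, coe_altT, coe_altT, hv] at this
    exact this.symm

lemma OddVal_val (D : HopfData H) (A : MAlg D B) (P : MRep H ι) {n : ℕ} (f : Raw H B (2 * n + 1))
    (ω : H) (c : ℂ) (u w : Matrix ι ι B) (hu : OddVal D A P f ω c u) (hw : u * w = 1) :
    PsiRaw D P f ω (altT (2 * n + 2) u w) = c := by
  obtain ⟨u', h1, h2, hi, hv⟩ := hu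
  rw [← left_inv_eq_right_inv h2 hw]; exact hv

lemma PsiRaw_blocks (D : HopfData H) (P : MRep H ι) (Q : MRep H κ)
    (R : MRep H (ι ⊕ κ)) (hR : ∀ ω : H, R.π ω = Matrix.fromBlocks (P.π ω) 0 0 (Q.π ω))
    {m : ℕ} (f : Raw H B m) (hf : IsML f) (ω : H)
    (a : Fin (m + 1) → Matrix ι ι B) (d : Fin (m + 1) → Matrix κ κ B) :
    PsiRaw D R f ω (fun i => Matrix.fromBlocks (a i) 0 0 (d i)) =
      PsiRaw D P f ω a + PsiRaw D Q f ω d := by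
  simp only [PsiRaw_eq D _ f hf]
  exact Psi_blocks D P Q R hR _ ω a d

lemma PsiRaw_zero (D : HopfData H) (P : MRep H ι) {m : ℕ} (f : Raw H B m) (hf : IsML f) (ω : H) :
    PsiRaw D P f ω (fun _ => 0) = 0 := by
  rw [PsiRaw_eq D _ f hf]
  exact (PsiM D P (toF f hf) ω).map_coord_zero 0 rfl

lemma altT_blocks (m : ℕ) (u u' : Matrix ι ι B) (v v' : Matrix κ κ B) :
    altT m (Matrix.fromBlocks u 0 0 v) (Matrix.fromBlocks u' 0 0 v') =
      fun i => Matrix.fromBlocks (altT m u u' i) 0 0 (altT m v v' i) := by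
  funext i
  unfold altT
  simp only [sub_eq_add_neg, ← Matrix.fromBlocks_one, Matrix.fromBlocks_neg]
  split_ifs <;> simp [Matrix.fromBlocks_add]

lemma altT_one (m : ℕ) : altT m (1 : Matrix ι ι B) 1 = fun _ => 0 := by
  funext i; simp [altT]

lemma pf_E2 (D : HopfData H) (A : MAlg D B) (P : MRep H ι) (Q : MRep H κ) {n : ℕ}
    (f : Raw H B (2 * n)) (hf : IsCocycle D A.fn f) (ω : H)
    (p : Matrix ι ι B) (p' : Matrix κ κ B) (hp : p * p = p) (hp' : p' * p' = p')
    (γ : Matrix κ ι B) (γ' : Matrix ι κ B) (hpi : MInv D A.toRAct P P p)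
    (hpi' : MInv D A.toRAct Q Q p') (hγ : MInv D A.toRAct P Q γ) (hγ' : MInv D A.toRAct Q P γ')
    (h1 : γ * γ' = p') (h2 : γ' * γ = p) :
    PsiRaw D P f ω (fun _ => p) = PsiRaw D Q f ω fun _ => p' := by
  have hx := MInv_mul D A Q P P p γ' hpi hγ'
  have hy := MInv_mul D A P P Q γ p hγ hpi
  have a1 : p * (p * γ') = p * γ' := by rw [← Matrix.mul_assoc, hp]
  have a2 : p * γ' * p' = p * γ' := by
    rw [← h1, Matrix.mul_assoc, ← Matrix.mul_assoc γ', h2, a1]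
  have a3 : p * γ' * (γ * p) = p := by
    rw [Matrix.mul_assoc, ← Matrix.mul_assoc γ', h2, hp, hp]
  have a4 : γ * p * (p * γ') = p' := by
    rw [Matrix.mul_assoc, a1, ← h2, Matrix.mul_assoc, h1, ← Matrix.mul_assoc, h1, hp']
  have a5 : γ * p * p = γ * p := by rw [Matrix.mul_assoc, hp]
  have a6 : p' * (γ * p) = γ * p := by
    rw [← h1, Matrix.mul_assoc, ← Matrix.mul_assoc γ', h2, hp]
  generalize p * γ' = x at *
  generalize γ * p = y at *
  have hR : ∀ ω : H, (P.dsum Q).π ω = Matrix.fromBlocks (P.π ω) 0 0 (Q.π ω) := fun _ => rfl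
  have s1 := Psi_path D A (P.dsum Q) f hf ω (Matrix.fromBlocks p 0 0 0) (Matrix.fromBlocks p x 0 0)
    (MInv_blocks D _ P Q _ hR _ _ _ _ hpi (MInv_zero D A.toRAct _ _) (MInv_zero D A.toRAct _ _) (MInv_zero D A.toRAct _ _))
    (MInv_blocks D _ P Q _ hR _ _ _ _ hpi hx (MInv_zero D A.toRAct _ _) (MInv_zero D A.toRAct _ _))
    (by simp [Matrix.fromBlocks_multiply, hp]) (by simp [Matrix.fromBlocks_multiply, hp, a1])
    (Or.inr (by simp [Matrix.fromBlocks_multiply, hp, a1]))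
  have s2 := Psi_path D A (P.dsum Q) f hf ω (Matrix.fromBlocks p x 0 0) (Matrix.fromBlocks 0 0 y p')
    (MInv_blocks D _ P Q _ hR _ _ _ _ hpi hx (MInv_zero D A.toRAct _ _) (MInv_zero D A.toRAct _ _))
    (MInv_blocks D _ P Q _ hR _ _ _ _ (MInv_zero D A.toRAct _ _) (MInv_zero D A.toRAct _ _) hy hpi')
    (by simp [Matrix.fromBlocks_multiply, hp, a1]) (by simp [Matrix.fromBlocks_multiply, hp', a6])
    (Or.inl (by simp [Matrix.fromBlocks_multiply, a2, a3, a4, a5]))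
  have s3 := Psi_path D A (P.dsum Q) f hf ω (Matrix.fromBlocks 0 0 y p') (Matrix.fromBlocks 0 0 0 p')
    (MInv_blocks D _ P Q _ hR _ _ _ _ (MInv_zero D A.toRAct _ _) (MInv_zero D A.toRAct _ _) hy hpi')
    (MInv_blocks D _ P Q _ hR _ _ _ _ (MInv_zero D A.toRAct _ _) (MInv_zero D A.toRAct _ _) (MInv_zero D A.toRAct _ _) hpi')
    (by simp [Matrix.fromBlocks_multiply, hp', a6]) (by simp [Matrix.fromBlocks_multiply, hp'])
    (Or.inr (by simp [Matrix.fromBlocks_multiply, hp', a6]))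
  have s := s1.trans (s2.trans s3)
  rw [PsiRaw_blocks D P Q _ hR f hf.1.1 ω (fun _ => p) (fun _ => 0),
    PsiRaw_blocks D P Q _ hR f hf.1.1 ω (fun _ => 0) (fun _ => p'),
    PsiRaw_zero D _ f hf.1.1, PsiRaw_zero D _ f hf.1.1] at s
  simpa using s

lemma OddVal_diag (D : HopfData H) (A : MAlg D B) (P : MRep H ι) (Q : MRep H κ)
    (R : MRep H (ι ⊕ κ)) (hR : ∀ ω : H, R.π ω = Matrix.fromBlocks (P.π ω) 0 0 (Q.π ω)) {n : ℕ}
    (f : Raw H B (2 * n + 1)) (hf : IsML f) (ω : H)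
    (u u' : Matrix ι ι B) (v v' : Matrix κ κ B) (h1 : u * u' = 1) (h2 : u' * u = 1)
    (h3 : v * v' = 1) (h4 : v' * v = 1)
    (hu : MInv D A.toRAct P P u) (hv : MInv D A.toRAct Q Q v) :
    OddVal D A R f ω (PsiRaw D P f ω (altT (2 * n + 2) u u') +
      PsiRaw D Q f ω (altT (2 * n + 2) v v')) (Matrix.fromBlocks u 0 0 v) := by
  refine ⟨Matrix.fromBlocks u' 0 0 v', by simp [Matrix.fromBlocks_multiply, h1, h3],
    by simp [Matrix.fromBlocks_multiply, h2, h4],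
    MInv_blocks D _ P Q _ hR _ _ _ _ hu (MInv_zero D _ _ _) (MInv_zero D _ _ _) hv, ?_⟩
  rw [altT_blocks]
  exact PsiRaw_blocks D P Q R hR f hf ω _ _

lemma pf_O4 (D : HopfData H) (A : MAlg D B) (P : MRep H ι) (Q : MRep H κ)
    (R : MRep H (ι ⊕ κ)) (hR : ∀ ω : H, R.π ω = Matrix.fromBlocks (P.π ω) 0 0 (Q.π ω)) {n : ℕ}
    (f : Raw H B (2 * n + 1)) (hf : IsCocycle D A.fn f) (ω : H)
    (u u' : Matrix ι ι B) (v v' : Matrix κ κ B) (T : Matrix ι κ B)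
    (h1 : u * u' = 1) (h2 : u' * u = 1)
    (h3 : v * v' = 1) (h4 : v' * v = 1)
    (hu : MInv D A.toRAct P P u) (hv : MInv D A.toRAct Q Q v) (hT : MInv D A.toRAct Q P T)
    (w : Matrix (ι ⊕ κ) (ι ⊕ κ) B) (hw : Matrix.fromBlocks u T 0 v * w = 1) :
    PsiRaw D R f ω (altT (2 * n + 2) (Matrix.fromBlocks u T 0 v) w) =
      PsiRaw D P f ω (altT (2 * n + 2) u u') + PsiRaw D Q f ω (altT (2 * n + 2) v v') := by
  have hd := OddVal_diag D A P Q R hR f hf.1.1 ω u u' v v' h1 h2 h3 h4 hu hv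
  have hs := OddVal_step D A R f hf ω _ _ (Matrix.fromBlocks 0 (u' * T) 0 0) hd
    (MInv_blocks D _ P Q _ hR _ _ _ _ (MInv_zero D _ _ _)
      (MInv_mul D A Q P P _ _ (MInv_inv D A P u u' h1 h2 hu) hT) (MInv_zero D _ _ _)
      (MInv_zero D _ _ _)) (by simp [Matrix.fromBlocks_multiply])
  have e : Matrix.fromBlocks u 0 0 v * (1 + Matrix.fromBlocks 0 (u' * T) 0 0) =
      Matrix.fromBlocks u T 0 v := by
    rw [← Matrix.fromBlocks_one, Matrix.fromBlocks_add, Matrix.fromBlocks_multiply]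
    simp [← Matrix.mul_assoc, h1]
  rw [e] at hs
  exact OddVal_val D A R f ω _ _ w hs hw

lemma pf_O3 (D : HopfData H) (A : MAlg D B) (P : MRep H ι) {n : ℕ}
    (f : Raw H B (2 * n + 1)) (hf : IsCocycle D A.fn f) (ω : H)
    (u u' v v' : Matrix ι ι B) (h1 : u * u' = 1) (h2 : u' * u = 1)
    (h3 : v * v' = 1) (h4 : v' * v = 1)
    (hu : MInv D A.toRAct P P u) (hv : MInv D A.toRAct P P v) :
    PsiRaw D P f ω (altT (2 * n + 2) (u * v) (v' * u')) =
      PsiRaw D P f ω (altT (2 * n + 2) u u') + PsiRaw D P f ω (altT (2 * n + 2) v v') := by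
  have hR : ∀ ω : H, (P.dsum P).π ω = Matrix.fromBlocks (P.π ω) 0 0 (P.π ω) := fun _ => rfl
  have z := MInv_zero (B := B) D A.toRAct P P
  have o := MInv_one D A P
  have hv' := MInv_inv D A P v v' h3 h4 hv
  have k1 : u * v * (v' * u') = 1 := by rw [mul_assoc, ← mul_assoc v, h3, one_mul, h1]
  have k2 : v' * u' * (u * v) = 1 := by rw [mul_assoc, ← mul_assoc u', h2, one_mul, h4]
  have c0 := OddVal_diag D A P P (P.dsum P) hR f hf.1.1 ω (u * v) (v' * u') 1 1 k1 k2
    (one_mul _) (one_mul _) (MInv_mul D A P P P _ _ hu hv) o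
  rw [altT_one, PsiRaw_zero D P f hf.1.1 ω, add_zero] at c0
  have up : ∀ (c : ℂ) (U x : _), OddVal D A (P.dsum P) f ω c U → MInv D A.toRAct P P x →
      OddVal D A (P.dsum P) f ω c (U * (1 + Matrix.fromBlocks 0 x 0 0)) := fun c U x hU hx =>
    OddVal_step D A _ f hf ω c U _ hU (MInv_blocks D _ P P _ hR _ _ _ _ z hx z z)
      (by simp [Matrix.fromBlocks_multiply])
  have lo : ∀ (c : ℂ) (U x : _), OddVal D A (P.dsum P) f ω c U → MInv D A.toRAct P P x →
      OddVal D A (P.dsum P) f ω c (U * (1 + Matrix.fromBlocks 0 0 x 0)) := fun c U x hU hx =>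
    OddVal_step D A _ f hf ω c U _ hU (MInv_blocks D _ P P _ hR _ _ _ _ z z hx z)
      (by simp [Matrix.fromBlocks_multiply])
  have c1 := up _ _ _ c0 hv'
  have c2 := lo _ _ _ c1 (MInv_neg D _ P P _ hv)
  have c3 := up _ _ _ c2 (MInv_add D _ P P _ _ hv' (MInv_neg D _ P P _ o))
  have c4 := lo _ _ _ c3 o
  have c5 := up _ _ _ c4 (MInv_neg D _ P P _ o)
  have e : Matrix.fromBlocks (u * v) 0 0 1 * (1 + Matrix.fromBlocks 0 v' 0 0) *
      (1 + Matrix.fromBlocks 0 0 (-v) 0) * (1 + Matrix.fromBlocks 0 (v' + -1) 0 0) *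
      (1 + Matrix.fromBlocks 0 0 1 0) * (1 + Matrix.fromBlocks 0 (-1) 0 0) =
      Matrix.fromBlocks u 0 0 v := by
    simp only [← Matrix.fromBlocks_one, Matrix.fromBlocks_add, Matrix.fromBlocks_multiply]
    simp [mul_add, add_mul, mul_assoc, h3, h4]
  rw [e] at c5
  have f1 := OddVal_val D A _ f ω _ _ (Matrix.fromBlocks u' 0 0 v') c5
    (by simp [Matrix.fromBlocks_multiply, h1, h3])
  rw [← f1, altT_blocks]
  exact PsiRaw_blocks D P P _ hR f hf.1.1 ω _ _

end Concrete


/-- the formulas `⟨[f],[p]⟩(ω) = (Ψ^{2n} f)(ω ⊗ p ⊗ ⋯ ⊗ p)` and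
`⟨[f],[u]⟩(ω) = (Ψ^{2n+1} f)(ω ⊗ (u⁻¹-1) ⊗ (u-1) ⊗ ⋯ ⊗ (u⁻¹-1) ⊗ (u-1))` define
pairings `HC^{2n}_H(B) × K₀^H(B) → R(H)` and `HC^{2n+1}_H(B) × K₁^H(B) → R(H)`:
the values are `H`-invariant functionals on `H`, they only depend on the cyclic
cohomology class of `f`, on the equivalence class of the invariant idempotent `p`,
resp. are additive in the `K₁`-variable (`⟨f,uv⟩ = ⟨f,u⟩ + ⟨f,v⟩`, stability, and
additivity over triangular elements). -/
theorem equivariant_pairing_with_K_theory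
    {H : Type} [Ring H] [HopfAlgebra ℂ H] (D : HopfData H)
    {B : Type} [Ring B] [Algebra ℂ B] (A : MAlg D B) :
    -- (E1) the even pairing takes values in R(H)
    (∀ (n : ℕ) (ι : Type) [Fintype ι] [DecidableEq ι],
      ∀ (P : MRep H ι) (p : Matrix ι ι B), p * p = p →
      (∀ ω : H, matAct D P A.toRAct ω p = epsi ω • p) →
      ∀ f : Raw H B (2 * n), IsCocycle D A.fn f →
        IsRH D fun ω => PsiRaw D P f ω fun _ => p) ∧
    -- (E2) it only depends on the equivalence class of the idempotent
    (∀ (n : ℕ) (ι κ : Type) [Fintype ι] [DecidableEq ι] [Fintype κ] [DecidableEq κ],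
      ∀ (P : MRep H ι) (Q : MRep H κ) (p : Matrix ι ι B) (p' : Matrix κ κ B),
      p * p = p → p' * p' = p' →
      (∀ ω : H, matAct D P A.toRAct ω p = epsi ω • p) →
      (∀ ω : H, matAct D Q A.toRAct ω p' = epsi ω • p') →
      ∀ (γ : Matrix κ ι B) (γ' : Matrix ι κ B),
        (∀ ω : H, matActR D P Q A.toRAct ω γ = epsi ω • γ) →
        (∀ ω : H, matActR D Q P A.toRAct ω γ' = epsi ω • γ') →
        γ * γ' = p' → γ' * γ = p →
      ∀ f : Raw H B (2 * n), IsCocycle D A.fn f →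
        ∀ ω : H, PsiRaw D P f ω (fun _ => p) = PsiRaw D Q f ω fun _ => p') ∧
    -- (E3) it vanishes on coboundaries, so depends only on the class of `f`
    (∀ (n : ℕ) (ι : Type) [Fintype ι] [DecidableEq ι],
      ∀ (P : MRep H ι) (p : Matrix ι ι B), p * p = p →
      (∀ ω : H, matAct D P A.toRAct ω p = epsi ω • p) →
      ∀ g : Raw H B (2 * n + 1), InC D A.fn g → IsCyc D A.fn g →
        ∀ ω : H, PsiRaw D P (bRaw D A.fn g) ω (fun _ => p) = 0) ∧
    -- (E4) stability: `p` and `p ⊕ 0` pair equally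
    (∀ (n : ℕ) (ι κ : Type) [Fintype ι] [DecidableEq ι] [Fintype κ] [DecidableEq κ],
      ∀ (P : MRep H ι) (Q : MRep H κ) (R : MRep H (ι ⊕ κ)),
      (∀ ω : H, R.π ω = Matrix.fromBlocks (P.π ω) 0 0 (Q.π ω)) →
      ∀ (p : Matrix ι ι B), p * p = p →
      (∀ ω : H, matAct D P A.toRAct ω p = epsi ω • p) →
      ∀ f : Raw H B (2 * n), IsCocycle D A.fn f →
        ∀ ω : H, PsiRaw D R f ω (fun _ => Matrix.fromBlocks p 0 0 0)
          = PsiRaw D P f ω fun _ => p) ∧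
    -- (O1) the odd pairing takes values in R(H)
    (∀ (n : ℕ) (ι : Type) [Fintype ι] [DecidableEq ι],
      ∀ (P : MRep H ι) (u u' : Matrix ι ι B), u * u' = 1 → u' * u = 1 →
      (∀ ω : H, matAct D P A.toRAct ω u = epsi ω • u) →
      ∀ f : Raw H B (2 * n + 1), IsCocycle D A.fn f →
        IsRH D fun ω => PsiRaw D P f ω (altT (2 * n + 2) u u')) ∧
    -- (O2) it vanishes on coboundaries
    (∀ (n : ℕ) (ι : Type) [Fintype ι] [DecidableEq ι],
      ∀ (P : MRep H ι) (u u' : Matrix ι ι B), u * u' = 1 → u' * u = 1 →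
      (∀ ω : H, matAct D P A.toRAct ω u = epsi ω • u) →
      ∀ g : Raw H B (2 * n), InC D A.fn g → IsCyc D A.fn g →
        ∀ ω : H, PsiRaw D P (bRaw D A.fn g) ω (altT (2 * n + 2) u u') = 0) ∧
    -- (O3) additivity: `⟨f, uv⟩ = ⟨f, u⟩ + ⟨f, v⟩`
    (∀ (n : ℕ) (ι : Type) [Fintype ι] [DecidableEq ι],
      ∀ (P : MRep H ι) (u u' v v' : Matrix ι ι B),
      u * u' = 1 → u' * u = 1 → v * v' = 1 → v' * v = 1 →
      (∀ ω : H, matAct D P A.toRAct ω u = epsi ω • u) →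
      (∀ ω : H, matAct D P A.toRAct ω v = epsi ω • v) →
      ∀ f : Raw H B (2 * n + 1), IsCocycle D A.fn f →
        ∀ ω : H, PsiRaw D P f ω (altT (2 * n + 2) (u * v) (v' * u'))
          = PsiRaw D P f ω (altT (2 * n + 2) u u')
            + PsiRaw D P f ω (altT (2 * n + 2) v v')) ∧
    -- (O4) additivity over triangular elements (split exact sequences)
    (∀ (n : ℕ) (ι κ : Type) [Fintype ι] [DecidableEq ι] [Fintype κ] [DecidableEq κ],
      ∀ (P : MRep H ι) (Q : MRep H κ) (R : MRep H (ι ⊕ κ)),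
      (∀ ω : H, R.π ω = Matrix.fromBlocks (P.π ω) 0 0 (Q.π ω)) →
      ∀ (u u' : Matrix ι ι B) (v v' : Matrix κ κ B) (T : Matrix ι κ B),
      u * u' = 1 → u' * u = 1 → v * v' = 1 → v' * v = 1 →
      (∀ ω : H, matAct D P A.toRAct ω u = epsi ω • u) →
      (∀ ω : H, matAct D Q A.toRAct ω v = epsi ω • v) →
      (∀ ω : H, matActR D Q P A.toRAct ω T = epsi ω • T) →
      ∀ w : Matrix (ι ⊕ κ) (ι ⊕ κ) B,
        Matrix.fromBlocks u T 0 v * w = 1 → w * Matrix.fromBlocks u T 0 v = 1 →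
      ∀ f : Raw H B (2 * n + 1), IsCocycle D A.fn f →
        ∀ ω : H, PsiRaw D R f ω (altT (2 * n + 2) (Matrix.fromBlocks u T 0 v) w)
          = PsiRaw D P f ω (altT (2 * n + 2) u u')
            + PsiRaw D Q f ω (altT (2 * n + 2) v v')) := by
  refine ⟨?_, ?_, ?_, ?_, ?_, ?_, ?_, ?_⟩
  · intro n ι _ _ P p hp hpi f hf
    exact Psi_RH D A P f hf.1.1 hf.1.2 _ fun _ => MInv_of D A.toRAct P P p hpi
  · intro n ι κ _ _ _ _ P Q p p' hp hp' hpi hpi' γ γ' hγ hγ' h1 h2 f hf ω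
    exact pf_E2 D A P Q f hf ω p p' hp hp' γ γ' (MInv_of D A.toRAct P P p hpi)
      (MInv_of D A.toRAct Q Q p' hpi') (MInv_of D A.toRAct P Q γ hγ)
      (MInv_of D A.toRAct Q P γ' hγ') h1 h2
  · intro n ι _ _ P p hp hpi g hg hc ω
    have h := phiE_bnd D A P g hg.1 ω (fun _ => ⟨p, MInv_of D A.toRAct P P p hpi⟩)
    rw [even_bnd _ (phiE_cyc D A P g hg.1 hc ω) _ (Subtype.ext hp)] at h
    exact h
  · intro n ι κ _ _ _ _ P Q R hR p hp hpi f hf ω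
    have h := PsiRaw_blocks D P Q R hR f hf.1.1 ω (fun _ => p) (fun _ => 0)
    rw [PsiRaw_zero D _ f hf.1.1, add_zero] at h
    exact h
  · intro n ι _ _ P u u' h1 h2 hui f hf
    have hu := MInv_of D A.toRAct P P u hui
    refine Psi_RH D A P f hf.1.1 hf.1.2 _ fun i => ?_
    have hS : ∀ x ∈ invAlg D A P, x - 1 ∈ invAlg D A P := fun x hx => sub_mem hx (one_mem _)
    unfold altT
    split_ifs
    · exact hS u' (MInv_inv D A P u u' h1 h2 hu)
    · exact hS u hu
  · intro n ι _ _ P u u' h1 h2 hui g hg hc ω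
    have hu := MInv_of D A.toRAct P P u hui
    have h := phiE_bnd D A P g hg.1 ω (altT (2 * n + 2) ⟨u, hu⟩ ⟨u', MInv_inv D A P u u' h1 h2 hu⟩)
    rw [odd_bnd _ (phiE_cyc D A P g hg.1 hc ω) _ _ (Subtype.ext h1) (Subtype.ext h2),
      coe_altT] at h
    exact h
  · intro n ι _ _ P u u' v v' h1 h2 h3 h4 hu hv f hf ω
    exact pf_O3 D A P f hf ω u u' v v' h1 h2 h3 h4 (MInv_of D A.toRAct P P u hu)
      (MInv_of D A.toRAct P P v hv)
  · intro n ι κ _ _ _ _ P Q R hR u u' v v' T h1 h2 h3 h4 hu hv hT w hw1 hw2 f hf ω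
    exact pf_O4 D A P Q R hR f hf ω u u' v v' T h1 h2 h3 h4 (MInv_of D A.toRAct P P u hu)
      (MInv_of D A.toRAct Q Q v hv) (MInv_of D A.toRAct Q P T hT) w hw1


end
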